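/- arXiv:math/0405251 — 4 statements merged into one kernel-verified Lean document; each statement's English description precedes it below -/
import Mathlib

section
/- For any integers k ≥ 1 and m ≥ 1 there exists an integer N = N_vdW(k,m) ≥ 1 such that every colouring c: {1,...,N} → {1,...,m} of {1,...,N} into m colours contains at least one monochromatic arithmetic progression of length k, i.e. there exist a and r ≥ 1 with a, a+r, ..., a+(k-1)r ∈ {1,...,N} and c(a) = c(a+r) = ... = c(a+(k-1)r). -/
/-- **Van der Waerden's theorem.**  For any integers `k, m ≥ 1` there exists `N ≥ 1` such that
every colouring `c : {1,…,N} → {1,…,m}` contains a monochromatic arithmetic progression of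
length `k`, i.e. there are `a` and `r ≥ 1` with `a, a+r, …, a+(k-1)r ∈ {1,…,N}` and
`c` constant on this progression. -/
theorem van_der_waerden (k m : ℕ) (hk : 1 ≤ k) (hm : 1 ≤ m) :
    ∃ N : ℕ, 1 ≤ N ∧
      ∀ c : ℕ → ℕ, (∀ n ∈ Finset.Icc 1 N, c n ∈ Finset.Icc 1 m) →
        ∃ a r : ℕ, 1 ≤ r ∧ (∀ j < k, a + j * r ∈ Finset.Icc 1 N) ∧
          (∀ j < k, c (a + j * r) = c a) := by
  classical
  obtain ⟨ι, _inst, hι⟩ :=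
    Combinatorics.Line.exists_mono_in_high_dimension (Fin k) (Finset.Icc 1 m)
  have hbound : ∀ v : ι → Fin k,
      1 + ∑ i, (v i : ℕ) ∈ Finset.Icc 1 (1 + Fintype.card ι * k) := by
    intro v
    have h : ∑ i, (v i : ℕ) ≤ ∑ _i : ι, k := Finset.sum_le_sum fun i _ => (v i).2.le
    simp only [Finset.sum_const, Finset.card_univ, smul_eq_mul] at h
    rw [Finset.mem_Icc]
    omega
  refine ⟨1 + Fintype.card ι * k, by omega, fun c hc => ?_⟩
  obtain ⟨l, col, hl⟩ := hι fun v => ⟨c (1 + ∑ i, (v i : ℕ)), hc _ (hbound v)⟩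
  let z : Fin k := ⟨0, hk⟩
  let s : Finset ι := Finset.univ.filter fun i => l.idxFun i = none
  have hs : 1 ≤ s.card := by
    obtain ⟨i, hi⟩ := l.proper
    exact Finset.card_pos.mpr ⟨i, by simp [s, hi]⟩
  have key : ∀ x : Fin k,
      1 + ∑ i, ((l x i : Fin k) : ℕ) = (1 + ∑ i, ((l z i : Fin k) : ℕ)) + x * s.card := by
    intro x
    have h : ∀ i, ((l x i : Fin k) : ℕ) =
        ((l z i : Fin k) : ℕ) + if l.idxFun i = none then (x : ℕ) else 0 := by
      intro i
      rcases h : l.idxFun i with _ | y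
      · simp [Combinatorics.Line.apply_def, h, z]
      · simp [Combinatorics.Line.apply_def, h]
    rw [Finset.sum_congr rfl fun i _ => h i, Finset.sum_add_distrib, ← Finset.sum_filter,
      Finset.sum_const, smul_eq_mul, mul_comm (x : ℕ), add_assoc]
  refine ⟨1 + ∑ i, ((l z i : Fin k) : ℕ), s.card, hs, fun j hj => ?_, fun j hj => ?_⟩
  · have := key ⟨j, hj⟩
    rw [← this]
    exact hbound _
  · have := key ⟨j, hj⟩
    rw [← this]
    exact congrArg Subtype.val ((hl ⟨j, hj⟩).trans (hl z).symm)
end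

section
/- For any integer k ≥ 1 and real number 0 < δ ≤ 1, there exists an integer N_SZ(k,δ) ≥ 1 such that for every N ≥ N_SZ(k,δ), every set A ⊆ {1,...,N} of cardinality |A| ≥ δN contains at least one proper arithmetic progression of length k (i.e. there exist a and r ≥ 1 with a, a+r, ..., a+(k-1)r all in A). -/
namespace SzProof
open Classical
set_option linter.unusedSectionVars false

/-- Uniform average over a finite type. -/
noncomputable def E {X : Type} [Finite X] (f : X → ℝ) : ℝ :=
  letI := Fintype.ofFinite X
  (∑ x, f x) / Fintype.card X

lemma E_eq {X : Type} [Fintype X] (f : X → ℝ) : E f = (∑ x, f x) / Fintype.card X := by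
  unfold E
  have : Fintype.ofFinite X = ‹Fintype X› := Subsingleton.elim _ _
  rw [this]

section basic
variable {X Y : Type} [Finite X] [Finite Y]

lemma E_add (f g : X → ℝ) : E (fun x => f x + g x) = E f + E g := by
  cases nonempty_fintype X
  simp only [E_eq, Finset.sum_add_distrib, add_div]

lemma E_sub (f g : X → ℝ) : E (fun x => f x - g x) = E f - E g := by
  cases nonempty_fintype X
  simp only [E_eq, Finset.sum_sub_distrib, sub_div]

lemma E_mul (c : ℝ) (f : X → ℝ) : E (fun x => c * f x) = c * E f := by
  cases nonempty_fintype X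
  simp only [E_eq, ← Finset.mul_sum, mul_div_assoc]

lemma E_const [Nonempty X] (c : ℝ) : E (fun _ : X => c) = c := by
  cases nonempty_fintype X
  simp [E_eq]

lemma E_mono {f g : X → ℝ} (h : ∀ x, f x ≤ g x) : E f ≤ E g := by
  cases nonempty_fintype X
  simp only [E_eq]
  gcongr
  exact h _

lemma E_nonneg {f : X → ℝ} (h : ∀ x, 0 ≤ f x) : 0 ≤ E f := by
  cases nonempty_fintype X
  simp only [E_eq]
  have := Finset.sum_nonneg (fun x (_ : x ∈ Finset.univ) => h x)
  positivity

lemma E_equiv (e : X ≃ Y) (f : Y → ℝ) : E (fun x => f (e x)) = E f := by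
  cases nonempty_fintype X
  cases nonempty_fintype Y
  simp only [E_eq, Fintype.card_congr e, Equiv.sum_comp e f]

lemma E_prod (f : X × Y → ℝ) : E f = E (fun x => E (fun y => f (x, y))) := by
  cases nonempty_fintype X
  cases nonempty_fintype Y
  simp only [E_eq, Fintype.sum_prod_type, Fintype.card_prod, Finset.sum_div, Nat.cast_mul]
  simp only [div_div, mul_comm]

lemma E_comm (f : X → Y → ℝ) : E (fun x => E (fun y => f x y)) = E (fun y => E (fun x => f x y)) := by
  rw [← E_prod (fun p : X × Y => f p.1 p.2), ← E_prod (fun p : Y × X => f p.2 p.1),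
    ← E_equiv (Equiv.prodComm X Y)]
  rfl

lemma E_sum {I : Type} (s : Finset I) (f : I → X → ℝ) :
    E (fun x => ∑ i ∈ s, f i x) = ∑ i ∈ s, E (f i) := by
  cases nonempty_fintype X
  simp only [E_eq]
  rw [Finset.sum_comm, Finset.sum_div]

lemma exists_ge [Nonempty X] {f : X → ℝ} {c : ℝ} (h : c ≤ E f) : ∃ x, c ≤ f x := by
  cases nonempty_fintype X
  by_contra! hc
  have h1 : ∑ x, f x < ∑ _x : X, c :=
    Finset.sum_lt_sum_of_nonempty Finset.univ_nonempty (fun x _ => hc x)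
  rw [E_eq, le_div_iff₀ (by exact_mod_cast Fintype.card_pos)] at h
  simp at h1
  linarith

/-- indicator function -/
noncomputable def ind (A : Set X) (x : X) : ℝ := if x ∈ A then 1 else 0

lemma ind_nonneg (A : Set X) (x : X) : 0 ≤ ind A x := by unfold ind; split_ifs <;> norm_num
lemma ind_le_one (A : Set X) (x : X) : ind A x ≤ 1 := by unfold ind; split_ifs <;> norm_num

/-- density -/
noncomputable def mu (A : Set X) : ℝ := E (ind A)

lemma mu_nonneg (A : Set X) : 0 ≤ mu A := E_nonneg (ind_nonneg A)
lemma mu_le_one [Nonempty X] (A : Set X) : mu A ≤ 1 :=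
  (E_mono (ind_le_one A)).trans (E_const (X := X) 1).le

lemma mu_mono {A B : Set X} (h : A ⊆ B) : mu A ≤ mu B := by
  refine E_mono fun x => ?_
  unfold ind
  split_ifs with h1 h2
  · exact le_rfl
  · exact absurd (h h1) h2
  · norm_num
  · exact le_rfl

lemma mu_nonempty {A : Set X} (h : 0 < mu A) : A.Nonempty := by
  by_contra hA
  rw [Set.not_nonempty_iff_eq_empty] at hA
  subst hA
  have : mu (∅ : Set X) ≤ 0 := by
    cases nonempty_fintype X
    simp [mu, E_eq, ind]
  linarith

lemma pigeon [Nonempty X] [Nonempty Y] {Φ : Type} [Finite Φ] (A : Y → Set X) {b : ℝ} (hb : 0 < b)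
    (hA : b ≤ E (fun y => mu (A y))) (Q : Φ → Set X → Prop)
    (h : ∀ y, b / 2 ≤ mu (A y) → ∃ φ, Q φ (A y)) :
    ∃ φ, b / 2 / Nat.card Φ ≤ mu {y | Q φ (A y)} := by
  cases nonempty_fintype Φ
  have key : ∀ y, mu (A y) ≤ b / 2 + ∑ φ, ind {y | Q φ (A y)} y := by
    intro y
    have hs : 0 ≤ ∑ φ, ind {y | Q φ (A y)} y := Finset.sum_nonneg fun φ _ => ind_nonneg _ _
    by_cases hy : b / 2 ≤ mu (A y)
    · obtain ⟨φ, hφ⟩ := h _ hy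
      have h1 : ind {y | Q φ (A y)} y = 1 := by simp [ind, hφ]
      have h2 : ind {y | Q φ (A y)} y ≤ ∑ φ, ind {y | Q φ (A y)} y :=
        Finset.single_le_sum (f := fun φ => ind {y | Q φ (A y)} y)
          (fun φ _ => ind_nonneg _ _) (Finset.mem_univ φ)
      have := mu_le_one (A y)
      linarith
    · linarith
  have h2 := hA.trans (E_mono key)
  rw [E_add, E_const, E_sum] at h2
  by_contra! hc
  rcases isEmpty_or_nonempty Φ with hΦ | hΦ
  · simp at h2; linarith
  · have h3 : ∑ φ, mu {y | Q φ (A y)} < ∑ _φ : Φ, b / 2 / Nat.card Φ :=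
      Finset.sum_lt_sum_of_nonempty Finset.univ_nonempty (fun x _ => hc x)
    have h4 : (Fintype.card Φ : ℝ) ≠ 0 := by exact_mod_cast Fintype.card_ne_zero
    simp only [Finset.sum_const, Finset.card_univ, nsmul_eq_mul, Nat.card_eq_fintype_card] at h3
    rw [mul_div_cancel₀ _ h4] at h3
    simp only [mu] at h3
    linarith

end basic

section words
variable {ι κ m β α : Type} [Finite ι] [Finite κ] [Finite m] [Finite β] [Finite α]

lemma E_words (f : (ι ⊕ κ → β) → ℝ) :
    E f = E (fun x : ι → β => E (fun y : κ → β => f (Sum.elim x y))) := by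
  rw [← E_prod (fun p : (ι → β) × (κ → β) => f (Sum.elim p.1 p.2)),
    ← E_equiv (Equiv.sumArrowEquivProdArrow ι κ β).symm]
  rfl

lemma E_words' (f : (ι ⊕ κ → β) → ℝ) :
    E f = E (fun y : κ → β => E (fun x : ι → β => f (Sum.elim x y))) := by
  rw [E_words, E_comm]

end words

section words2
variable {ι κ m β α : Type}

/-- evaluation of a subspace -/
def ev (φ : ι → β ⊕ m) (x : m → β) (i : ι) : β := Sum.elim id x (φ i)

/-- every wildcard is used -/
def Pr (φ : ι → β ⊕ m) : Prop := ∀ j, ∃ i, φ i = Sum.inr j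

/-- contains a combinatorial line -/
def HasLine (A : Set (ι → β)) : Prop :=
  ∃ l : ι → Option β, (∃ j, l j = none) ∧ ∀ b, (fun j => (l j).getD b) ∈ A

lemma HasLine.pull {φ : ι → β ⊕ m} (hφ : Pr φ) {A : Set (ι → β)} (h : HasLine (ev φ ⁻¹' A)) :
    HasLine A := by
  obtain ⟨l, ⟨j, hj⟩, hl⟩ := h
  obtain ⟨i, hi⟩ := hφ j
  refine ⟨fun i => Sum.elim some l (φ i), ⟨i, by simp [hi, hj]⟩, fun b => ?_⟩
  have hb := hl b
  rw [Set.mem_preimage] at hb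
  convert hb using 1
  funext i
  cases h : φ i <;> simp [ev, h]

/-- density level suffices -/
def Good (β : Type) [Finite β] (δ : ℝ) : Prop :=
  ∃ (ι : Type) (_ : Finite ι), ∀ A : Set (ι → β), δ ≤ mu A → HasLine A

def DensHJ (β : Type) [Finite β] : Prop := ∀ δ > 0, Good β δ

def MDHJ (α m : Type) [Finite α] : Prop := ∀ δ : ℝ, δ > 0 →
  ∃ (ι : Type) (_ : Finite ι), ∀ A : Set (ι → α), δ ≤ mu A →
    ∃ φ : ι → α ⊕ m, Pr φ ∧ ∀ v, ev φ v ∈ A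

lemma mdhj [Finite α] [Nonempty α] (h : DensHJ α) (m : Type) [Finite m] : MDHJ α m := by
  induction m using Finite.induction_empty_option with
  | of_equiv e ih =>
    rename_i m m'
    intro δ hδ
    obtain ⟨ι, hι, H⟩ := ih δ hδ
    refine ⟨ι, hι, fun A hA => ?_⟩
    obtain ⟨φ, hφ, hv⟩ := H A hA
    refine ⟨fun i => Sum.map id e (φ i), fun j => ?_, fun v => ?_⟩
    · obtain ⟨i, hi⟩ := hφ (e.symm j)
      exact ⟨i, by simp [hi]⟩
    · convert hv (fun j => v (e j)) using 1
      funext i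
      cases h : φ i <;> simp [ev, h]
  | h_empty =>
    intro δ hδ
    refine ⟨Empty, inferInstance, fun A hA => ?_⟩
    obtain ⟨x, hx⟩ := mu_nonempty (hδ.trans_le hA)
    exact ⟨fun i => i.elim, fun j => j.elim, fun v => by convert hx⟩
  | h_option ih =>
    rename_i m _
    intro δ hδ
    obtain ⟨ι, hι, H⟩ := h (δ / 2) (by linarith)
    have hc : 0 < (Nat.card (ι → Option α) : ℝ) := by exact_mod_cast Nat.card_pos
    obtain ⟨κ, hκ, K⟩ := ih (δ / 2 / Nat.card (ι → Option α)) (by positivity)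
    refine ⟨ι ⊕ κ, inferInstance, fun A hA => ?_⟩
    rw [mu, E_words'] at hA
    obtain ⟨l, hl⟩ := pigeon (fun y : κ → α => {x : ι → α | Sum.elim x y ∈ A}) hδ hA
      (fun (l : ι → Option α) B => (∃ j, l j = none) ∧ ∀ b, (fun j => (l j).getD b) ∈ B)
      (fun y hB => H _ hB)
    obtain ⟨φ, hφ, hv⟩ := K _ hl
    refine ⟨Sum.elim (fun i => (l i).elim (Sum.inr none) Sum.inl)
      (fun i => Sum.map id some (φ i)), fun j => ?_, fun v => ?_⟩
    · cases j with
      | none =>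
        obtain ⟨⟨j, hj⟩, -⟩ := hv (fun _ => Classical.arbitrary α)
        exact ⟨Sum.inl j, by simp [hj]⟩
      | some j =>
        obtain ⟨i, hi⟩ := hφ j
        exact ⟨Sum.inr i, by simp [hi]⟩
    · have := (hv (fun j => v (some j))).2 (v none)
      simp only [Set.mem_ofPred_eq] at this
      convert this using 1
      funext i
      rcases i with i | i
      · cases h : l i <;> simp [ev, h]
      · cases h : φ i <;> simp [ev, h]

end words2
end SzProof

namespace SzProof
open Classical
set_option linter.unusedSectionVars false

section resampling
variable {ι κ m β α : Type} [Finite ι] [Finite κ] [Finite m] [Finite β] [Finite α]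

lemma resample {g : κ → ι} (hg : Function.Injective g) [Nonempty (κ → β)] (F : (ι → β) → ℝ) :
    E (fun u => E (fun w : κ → β => F (Function.extend g w u))) = E F := by
  rw [← E_prod (fun p : (ι → β) × (κ → β) => F (Function.extend g p.2 p.1))]
  let e : (ι → β) × (κ → β) → (ι → β) × (κ → β) :=
    fun p => (Function.extend g p.2 p.1, fun j => p.1 (g j))
  have he : Function.Involutive e := by
    rintro ⟨u, w⟩
    simp only [e]
    ext i
    · by_cases hi : ∃ j, g j = i
      · obtain ⟨j, rfl⟩ := hi
        simp [hg.extend_apply]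
      · simp [Function.extend_apply' _ _ _ hi]
    · simp [hg.extend_apply]
  have := E_equiv he.toPerm (fun p : (ι → β) × (κ → β) => F p.1)
  rw [E_prod (fun p : (ι → β) × (κ → β) => F p.1)] at this
  simp only [E_const] at this
  exact this

lemma marginal {g : κ → ι} (hg : Function.Injective g) [Nonempty β] (F : (κ → β) → ℝ) :
    E (fun u : ι → β => F (fun j => u (g j))) = E F := by
  rw [← resample hg (fun u : ι → β => F (fun j => u (g j)))]
  simp [hg.extend_apply, E_const]

/-- mixing -/
def mixw (t : ι → Option α) (u : ι → α) (i : ι) : Option α := (t i).map (fun _ => u i)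

lemma mix [Nonempty α] (F : (ι → Option α) → ℝ) :
    E (fun t : ι → Option α => E (fun u : ι → α => F (mixw t u))) = E F := by
  rw [← E_prod (fun p : (ι → Option α) × (ι → α) => F (mixw p.1 p.2))]
  let e : (ι → Option α) × (ι → α) → (ι → Option α) × (ι → α) :=
    fun p => (mixw p.1 p.2, fun i => (p.1 i).getD (p.2 i))
  have he : Function.Involutive e := by
    rintro ⟨t, u⟩
    simp only [e]
    refine Prod.ext ?_ ?_ <;> funext i
    · cases h : t i <;> simp [mixw, h]
    · cases h : t i <;> simp [mixw, h]
  have := E_equiv he.toPerm (fun p : (ι → Option α) × (ι → α) => F p.1)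
  rw [E_prod (fun p : (ι → Option α) × (ι → α) => F p.1)] at this
  simp only [E_const] at this
  exact this

lemma mu_singleton {X : Type} [Finite X] (x : X) : mu ({x} : Set X) = 1 / Nat.card X := by
  cases nonempty_fintype X
  simp [mu, E_eq, ind]

end resampling

section ins
variable {ι κ m β α : Type}

/-- replace the extra letter by `a` -/
def rp (a : α) (x : ι → Option α) (i : ι) : Option α := some ((x i).getD a)

/-- insensitivity -/
def Ins (a : α) (D : Set (ι → Option α)) : Prop := ∀ x, x ∈ D ↔ rp a x ∈ D

lemma Ins.congr {a : α} {D : Set (ι → Option α)} (h : Ins a D) {x y : ι → Option α}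
    (hxy : rp a x = rp a y) : x ∈ D ↔ y ∈ D := by
  rw [h x, h y, hxy]

lemma Ins.compl {a : α} {D : Set (ι → Option α)} (h : Ins a D) : Ins a Dᶜ :=
  fun x => not_congr (h x)

lemma Ins.pull {a : α} {D : Set (ι → Option α)} (h : Ins a D) (q : (κ → Option α) → (ι → Option α))
    (hq : ∀ x, rp a (q x) = rp a (q (rp a x))) : Ins a (q ⁻¹' D) :=
  fun x => h.congr (hq x)

lemma rp_ev (a : α) (φ : ι → Option α ⊕ m) (x : m → Option α) :
    rp a (ev φ x) = rp a (ev φ (rp a x)) := by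
  funext i
  cases h : φ i <;> simp [rp, ev, h]

lemma rp_elim_left (a : α) (y : κ → Option α) (x : ι → Option α) :
    rp a (Sum.elim x y) = rp a (Sum.elim (rp a x) y) := by
  funext i
  cases i <;> simp [rp]

lemma rp_elim_right (a : α) (y : κ → Option α) (x : ι → Option α) :
    rp a (Sum.elim x y) = rp a (Sum.elim x (rp a y)) := by
  funext i
  cases i <;> simp [rp]

lemma ins_subspace [Finite α] [Nonempty α] (h : MDHJ α m) {b : ℝ} (hb : 0 < b) :
    ∃ (ι : Type) (_ : Finite ι), ∀ (a : α) (D : Set (ι → Option α)), Ins a D → b ≤ mu D →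
      ∃ φ : ι → Option α ⊕ m, Pr φ ∧ ∀ v, ev φ v ∈ D := by
  obtain ⟨κ, hκ, H⟩ := h (b / 2) (by linarith)
  cases nonempty_fintype κ
  have hlt : (1 / (Nat.card (Option α) : ℝ)) < 1 := by
    have : 1 < Nat.card (Option α) := Finite.one_lt_card
    rw [div_lt_one (by positivity)]
    exact_mod_cast this
  obtain ⟨n, hn⟩ := exists_pow_lt_of_lt_one (show 0 < b / 2 / (Fintype.card κ + 1) by positivity) hlt
  refine ⟨κ × Fin n, inferInstance, fun a D hD hmu => ?_⟩
  let T : Set (κ × Fin n → Option α) := {t | ∃ j, ∀ c, t (j, c) = none}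
  have hT : mu T ≤ b / 2 := by
    have h1 : ∀ t, ind T t ≤ ∑ j : κ, ind ({fun _ => none} : Set (Fin n → Option α))
        (fun c => t (j, c)) := by
      intro t
      by_cases ht : t ∈ T
      · obtain ⟨j, hj⟩ := ht
        refine (ind_le_one _ _).trans ?_
        have h2 : ind ({fun _ => none} : Set (Fin n → Option α)) (fun c => t (j, c)) = 1 := by
          simp [ind, hj]
        rw [← h2]
        exact Finset.single_le_sum (f := fun j => ind ({fun _ => none} : Set (Fin n → Option α))
          (fun c => t (j, c))) (fun φ _ => ind_nonneg _ _) (Finset.mem_univ j)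
      · have : ind T t = 0 := by simp [ind, ht]
        rw [this]
        exact Finset.sum_nonneg fun φ _ => ind_nonneg _ _
    refine (E_mono h1).trans ?_
    rw [E_sum]
    have h3 : ∀ j : κ, E (fun t : κ × Fin n → Option α =>
        ind ({fun _ => none} : Set (Fin n → Option α)) (fun c => t (j, c)))
        = (1 / (Nat.card (Option α) : ℝ)) ^ n := by
      intro j
      rw [marginal (g := fun c : Fin n => (j, c)) (fun c c' hcc => by simpa using hcc)
        (ind ({fun _ => none} : Set (Fin n → Option α)))]
      have := mu_singleton (fun _ : Fin n => (none : Option α))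
      rw [mu] at this
      rw [this, Nat.card_fun]
      simp
    simp only [h3, Finset.sum_const, Finset.card_univ, nsmul_eq_mul]
    rw [lt_div_iff₀ (by positivity)] at hn
    have : 0 ≤ (1 / (Nat.card (Option α) : ℝ)) ^ n := by positivity
    nlinarith
  have h4 : b / 2 ≤ E (fun t => mu {u | mixw t u ∈ D} - ind T t) := by
    rw [E_sub]
    have h5 := mix (ind D)
    have h6 : E (fun t => mu {u | mixw t u ∈ D}) = mu D := h5
    rw [h6]
    change _ ≤ mu D - mu T
    linarith
  obtain ⟨t, ht⟩ := exists_ge h4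
  have htT : t ∉ T := by
    intro hc
    have : ind T t = 1 := by simp [ind, hc]
    have := mu_le_one {u : κ × Fin n → α | mixw t u ∈ D}
    linarith
  have h7 : ind T t = 0 := by simp [ind, htT]
  rw [h7, sub_zero] at ht
  have h8 : ∀ j, ∃ c, t (j, c) ≠ none := by
    simpa [T] using htT
  choose g hg using h8
  have hinj : Function.Injective (fun j => (j, g j)) := fun x y hxy => by simp at hxy; exact hxy.1
  rw [mu, ← resample hinj] at ht
  obtain ⟨u, hu⟩ := exists_ge ht
  obtain ⟨ψ, hψ, hv⟩ := H {w | mixw t (Function.extend (fun j => (j, g j)) w u) ∈ D} hu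
  refine ⟨Function.extend (fun j => (j, g j)) (fun j => Sum.map some id (ψ j))
    (fun i => Sum.inl (mixw t u i)), fun j => ?_, fun v => ?_⟩
  · obtain ⟨i, hi⟩ := hψ j
    exact ⟨(i, g i), by rw [hinj.extend_apply (f := fun j => (j, g j))]; simp [hi]⟩
  · refine (hD.congr ?_).1 (hv (fun j => (v j).getD a))
    funext i
    by_cases hi : ∃ j, (fun j => (j, g j)) j = i
    · obtain ⟨j, rfl⟩ := hi
      simp only [rp, mixw, ev]
      rw [hinj.extend_apply (f := fun j => (j, g j)), hinj.extend_apply (f := fun j => (j, g j))]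
      obtain ⟨q, hq⟩ := Option.ne_none_iff_exists'.1 (hg j)
      cases h : ψ j <;> simp [ev, h, hq]
    · simp only [rp, mixw, ev]
      rw [Function.extend_apply' _ _ _ hi, Function.extend_apply' _ _ _ hi]
      simp

end ins
end SzProof

namespace SzProof
open Classical
set_option linter.unusedSectionVars false

lemma E_range {V X : Type} [Finite V] [Finite X] [Nonempty V] {e : V → X}
    (he : Function.Injective e) (g : X → ℝ) :
    E (fun x => ind (Set.range e) x * g x) = (Nat.card V / Nat.card X : ℝ) * E (fun v => g (e v)) := by
  cases nonempty_fintype V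
  cases nonempty_fintype X
  simp only [E_eq, Nat.card_eq_fintype_card]
  have h1 : ∑ x, ind (Set.range e) x * g x = ∑ v, g (e v) := by
    rw [← Finset.sum_image (s := Finset.univ) (g := e) (f := g) (fun a _ b _ hab => he hab)]
    rw [← Finset.sum_subset (Finset.subset_univ (Finset.univ.image e))]
    · refine Finset.sum_congr rfl fun x hx => ?_
      have : x ∈ Set.range e := by simpa using hx
      simp only [ind, if_pos this, one_mul]
    · intro x _ hx
      have : x ∉ Set.range e := by simpa using hx
      simp only [ind, if_neg this, zero_mul]
  rw [h1]
  have : (Fintype.card V : ℝ) ≠ 0 := by exact_mod_cast Fintype.card_ne_zero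
  field_simp

section cov
variable {ι κ m β α : Type}

/-- approximate covering by subspaces, in functional form -/
def Cov [Finite ι] [Finite m] [Finite β] (e : ℝ) (D : Set (ι → β)) : Prop :=
  ∀ f : (ι → β) → ℝ, (∀ x, f x ≤ 1) →
    (∀ φ : ι → β ⊕ m, Pr φ → E (fun v => f (ev φ v)) ≤ 0) → E (fun x => ind D x * f x) ≤ e

lemma ev_injective {φ : ι → β ⊕ m} (hφ : Pr φ) : Function.Injective (ev φ) := by
  intro x y hxy
  funext j
  obtain ⟨i, hi⟩ := hφ j
  simpa [ev, hi] using congrFun hxy i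

lemma ind_mul_le {X : Type} [Finite X] (D : Set X) {f : X → ℝ} (hf : ∀ x, f x ≤ 1) (x : X) :
    ind D x * f x ≤ ind D x := by
  have := ind_nonneg D x
  nlinarith [hf x]

lemma cov_step [Finite α] [Nonempty α] [Finite ι] [Finite κ] [Finite m] (a : α) {b c : ℝ}
    (hb : 0 < b) (hc : 0 ≤ c)
    (hι : ∀ D : Set (ι → Option α), Ins a D → b / 2 ≤ mu D →
      ∃ φ : ι → Option α ⊕ m, Pr φ ∧ ∀ v, ev φ v ∈ D)
    (K : ℝ) (hK : K = b / 2 / Nat.card (ι → Option α ⊕ m) * (1 / Nat.card (ι → Option α)))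
    (hK1 : K ≤ 1)
    (hκ : ∀ D : Set (κ → Option α), Ins a D → Cov (m := m) (b + c * mu D) D)
    (D : Set (ι ⊕ κ → Option α)) (hD : Ins a D) :
    Cov (m := m) (b + c * (1 - K) * mu D) D := by
  intro f hf1 hf
  have hcK : 0 ≤ c * (1 - K) * mu D :=
    mul_nonneg (mul_nonneg hc (by linarith)) (mu_nonneg D)
  by_cases hDb : b ≤ mu D
  swap
  · have : E (fun x => ind D x * f x) ≤ mu D := E_mono (ind_mul_le D hf1)
    linarith
  have hDb' := hDb
  rw [mu, E_words'] at hDb'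
  obtain ⟨φ, hφ⟩ := pigeon (fun y : κ → Option α => {x : ι → Option α | Sum.elim x y ∈ D}) hb hDb'
      (fun (φ : ι → Option α ⊕ m) B => Pr φ ∧ ∀ v, ev φ v ∈ B)
      (fun y hB => hι _ (hD.pull (fun x => Sum.elim x y) (rp_elim_left a y)) hB)
  set Y : Set (κ → Option α) :=
    {y | Pr φ ∧ ∀ v, ev φ v ∈ {x : ι → Option α | Sum.elim x y ∈ D}} with hY
  have hcard : 0 < (Nat.card (ι → Option α ⊕ m) : ℝ) := by
    have : Nonempty (ι → Option α ⊕ m) := ⟨φ⟩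
    exact_mod_cast Nat.card_pos
  have hcard2 : 0 < (Nat.card (ι → Option α) : ℝ) := by exact_mod_cast Nat.card_pos
  have hcard3 : 1 ≤ (Nat.card (m → Option α) : ℝ) := by
    exact_mod_cast (Nat.card_pos : 0 < Nat.card (m → Option α))
  obtain ⟨y0, hPr, -⟩ := mu_nonempty (lt_of_lt_of_le (by positivity) hφ)
  have hYins : Ins a Y := by
    intro y
    simp only [hY, Set.mem_ofPred_eq]
    refine and_congr_right fun _ => forall_congr' fun v => ?_
    exact hD.congr (rp_elim_right a y _)
  set V : Set (ι → Option α) := Set.range (ev φ) with hV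
  let D' : (ι → Option α) → Set (κ → Option α) := fun x =>
    {y | Sum.elim x y ∈ D ∧ ¬ (x ∈ V ∧ y ∈ Y)}
  have hD'ins : ∀ x, Ins a (D' x) := by
    intro x y
    refine and_congr ?_ (not_congr (and_congr_right fun _ => hYins y))
    exact hD.congr (rp_elim_right a y _)
  have hsplit : ∀ x y, ind D (Sum.elim x y) = ind V x * ind Y y + ind (D' x) y := by
    intro x y
    by_cases hx : x ∈ V
    · by_cases hy : y ∈ Y
      · have h1 : Sum.elim x y ∈ D := by
          obtain ⟨v, rfl⟩ := hx
          exact hy.2 v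
        have h2 : y ∉ D' x := fun h => h.2 ⟨hx, hy⟩
        simp [ind, hx, hy, h1, h2]
      · have h2 : y ∈ D' x ↔ Sum.elim x y ∈ D := ⟨fun h => h.1, fun h => ⟨h, fun h' => hy h'.2⟩⟩
        simp [ind, hy, h2]
    · have h2 : y ∈ D' x ↔ Sum.elim x y ∈ D := ⟨fun h => h.1, fun h => ⟨h, fun h' => hx h'.1⟩⟩
      simp [ind, hx, h2]
  set p : ℝ := Nat.card (m → Option α) / Nat.card (ι → Option α) with hp
  have hmuV : mu V = p := by
    have := E_range (ev_injective hPr) (fun _ => (1 : ℝ))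
    simp only [mul_one, E_const] at this
    exact this
  have hmuD : mu D = p * mu Y + E (fun x => mu (D' x)) := by
    rw [mu, E_words]
    simp only [hsplit, E_add, E_mul]
    congr 1
    rw [← hmuV, mul_comm]
    change _ = mu Y * E (ind V)
    rw [← E_mul]
    congr 1; funext x; rw [mul_comm]; rfl
  have hmain : E (fun w => ind D w * f w) =
      E (fun y => ind Y y * E (fun x => ind V x * f (Sum.elim x y)))
      + E (fun x => E (fun y => ind (D' x) y * f (Sum.elim x y))) := by
    rw [E_words]
    simp only [hsplit, add_mul, E_add]
    congr 1
    rw [E_comm]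
    congr 1; funext y; rw [← E_mul]; congr 1; funext x; ring
  have hfirst : E (fun y => ind Y y * E (fun x => ind V x * f (Sum.elim x y))) ≤ 0 := by
    have : ∀ y, ind Y y * E (fun x => ind V x * f (Sum.elim x y)) ≤ 0 := by
      intro y
      refine mul_nonpos_of_nonneg_of_nonpos (ind_nonneg _ _) ?_
      rw [hV, E_range (ev_injective hPr) (fun x => f (Sum.elim x y))]
      refine mul_nonpos_of_nonneg_of_nonpos (by positivity) ?_
      have hh := hf (Sum.elim φ (fun i => Sum.inl (y i))) (fun j => by
        obtain ⟨i, hi⟩ := hPr j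
        exact ⟨Sum.inl i, hi⟩)
      have he : ∀ v, ev (Sum.elim φ (fun i => Sum.inl (y i))) v = Sum.elim (ev φ v) y := by
        intro v; funext i; cases i <;> simp [ev]
      simp only [he] at hh
      exact hh
    exact (E_mono this).trans (E_const _).le
  have hsecond : E (fun x => E (fun y => ind (D' x) y * f (Sum.elim x y)))
      ≤ E (fun x => b + c * mu (D' x)) := by
    refine E_mono fun x => ?_
    refine hκ (D' x) (hD'ins x) (fun y => f (Sum.elim x y)) (fun y => hf1 _) ?_
    intro ψ hψ
    have hh := hf (Sum.elim (fun i => Sum.inl (x i)) ψ) (fun j => by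
      obtain ⟨i, hi⟩ := hψ j
      exact ⟨Sum.inr i, hi⟩)
    have he : ∀ v, ev (Sum.elim (fun i => Sum.inl (x i)) ψ) v = Sum.elim x (ev ψ v) := by
      intro v; funext i; cases i <;> simp [ev]
    simp only [he] at hh
    exact hh
  rw [E_add, E_const, E_mul] at hsecond
  have hKle : K ≤ p * mu Y := by
    rw [hK, mul_comm, hp]
    gcongr
  have h1 : K * mu D ≤ p * mu Y := by
    have hK0 : 0 ≤ K := by rw [hK]; positivity
    have := mu_le_one D
    nlinarith
  have h2 : E (fun x => mu (D' x)) ≤ (1 - K) * mu D := by linarith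
  have h3 := mul_le_mul_of_nonneg_left h2 hc
  rw [hmain]
  linarith

lemma cov_one [Finite α] [Nonempty α] [Finite m] (h : MDHJ α m) (a : α) {e : ℝ} (he : 0 < e) :
    ∃ (κ : Type) (_ : Finite κ), ∀ D : Set (κ → Option α), Ins a D → Cov (m := m) e D := by
  set b : ℝ := min (e / 2) 1 with hbdef
  have hb : 0 < b := by positivity
  have hbe : b ≤ e / 2 := min_le_left _ _
  have hb1 : b ≤ 1 := min_le_right _ _
  obtain ⟨ι, hι, H⟩ := ins_subspace h (half_pos hb)
  obtain ⟨K, hK⟩ : ∃ K : ℝ, K = b / 2 / Nat.card (ι → Option α ⊕ m) *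
    (1 / Nat.card (ι → Option α)) := ⟨_, rfl⟩
  have hcard : 0 < (Nat.card (ι → Option α ⊕ m) : ℝ) := by exact_mod_cast Nat.card_pos
  have hcard' : 1 ≤ (Nat.card (ι → Option α ⊕ m) : ℝ) := by
    exact_mod_cast (Nat.card_pos : 0 < Nat.card (ι → Option α ⊕ m))
  have hcard2 : 0 < (Nat.card (ι → Option α) : ℝ) := by exact_mod_cast Nat.card_pos
  have hcard2' : 1 ≤ (Nat.card (ι → Option α) : ℝ) := by
    exact_mod_cast (Nat.card_pos : 0 < Nat.card (ι → Option α))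
  have hK0 : 0 < K := by rw [hK]; positivity
  have hK1 : K ≤ 1 := by
    rw [hK]
    have h1 : b / 2 / Nat.card (ι → Option α ⊕ m) ≤ 1 := by
      rw [div_le_one hcard]; linarith
    have h2 : (1 : ℝ) / Nat.card (ι → Option α) ≤ 1 := by
      rw [div_le_one hcard2]; exact hcard2'
    exact mul_le_one₀ h1 (by positivity) h2
  have iter : ∀ t : ℕ, ∃ (κ : Type) (_ : Finite κ), ∀ D : Set (κ → Option α), Ins a D →
      Cov (m := m) (b + (1 - K) ^ t * mu D) D := by
    intro t
    induction t with
    | zero =>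
      refine ⟨Empty, inferInstance, fun D _ f hf1 _ => ?_⟩
      have : E (fun x => ind D x * f x) ≤ mu D := E_mono (ind_mul_le D hf1)
      rw [pow_zero, one_mul]
      linarith
    | succ t ih =>
      obtain ⟨κ, hκ, ih⟩ := ih
      refine ⟨ι ⊕ κ, inferInstance, fun D hD => ?_⟩
      rw [pow_succ]
      exact cov_step a hb (pow_nonneg (by linarith) t) (H a) K hK hK1 ih D hD
  obtain ⟨t, ht⟩ := exists_pow_lt_of_lt_one hb (show 1 - K < 1 by linarith)
  obtain ⟨κ, hκ, H2⟩ := iter t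
  refine ⟨κ, hκ, fun D hD f hf1 hf => (H2 D hD f hf1 hf).trans ?_⟩
  have h1 := mu_le_one D
  have h2 := mu_nonneg D
  have h3 : (1 - K) ^ t * mu D ≤ b := by
    have : 0 ≤ (1 - K) ^ t := pow_nonneg (by linarith) t
    nlinarith
  linarith

lemma ind_inter {X : Type} [Finite X] (A B : Set X) (x : X) :
    ind (A ∩ B) x = ind A x * ind B x := by
  by_cases h1 : x ∈ A <;> by_cases h2 : x ∈ B <;> simp [ind, h1, h2]

lemma cov_multi [Finite α] [Nonempty α] (h : ∀ (m : Type) [Finite m], MDHJ α m) (s : Finset α) :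
    ∀ (m : Type) [Finite m] (e : ℝ), 0 < e → ∃ (κ : Type) (_ : Finite κ),
      ∀ D : α → Set (κ → Option α), (∀ a, Ins a (D a)) →
        Cov (m := m) e {x | ∀ a ∈ s, x ∈ D a} := by
  induction s using Finset.induction_on with
  | empty =>
    intro m _ e he
    refine ⟨m, inferInstance, fun D _ f hf1 hf => ?_⟩
    have h1 := hf Sum.inr (fun j => ⟨j, rfl⟩)
    refine le_trans (le_of_eq ?_) (h1.trans he.le)
    congr 1
    funext x
    simp [ind]
    rfl
  | insert a s _ ih =>
    intro m _ e he
    obtain ⟨κ₁, hκ₁, H1⟩ := ih m (e / 2) (half_pos he)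
    obtain ⟨κ, hκ, H2⟩ := cov_one (h κ₁) a (half_pos he)
    refine ⟨κ, hκ, fun D hD f hf1 hf => ?_⟩
    set R : Set (κ → Option α) := {x | ∀ a ∈ s, x ∈ D a} with hR
    have hset : {x | ∀ c ∈ insert a s, x ∈ D c} = D a ∩ R := by
      ext x; simp [hR]
    have h3 := H2 (D a) (hD a) (fun x => ind R x * f x - e / 2)
      (fun x => by
        have := ind_mul_le R hf1 x
        have := ind_le_one R x
        linarith) ?_
    · have h4 : E (fun x => ind (D a) x * (ind R x * f x - e / 2)) =
        E (fun x => ind (D a ∩ R) x * f x) - e / 2 * mu (D a) := by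
        rw [mu, ← E_mul, ← E_sub]
        congr 1; funext x; rw [ind_inter]; ring
      rw [h4] at h3
      rw [hset]
      have := mu_le_one (D a)
      nlinarith
    · intro φ hφ
      rw [E_sub, E_const]
      have h5 := H1 (fun c => ev φ ⁻¹' D c) (fun c => (hD c).pull _ (rp_ev c φ))
        (fun v => f (ev φ v)) (fun v => hf1 _) ?_
      · have h6 : E (fun v => ind R (ev φ v) * f (ev φ v)) ≤ e / 2 := h5
        linarith
      · intro ψ hψ
        have hh := hf (fun i => Sum.elim Sum.inl ψ (φ i)) (fun j => by
          obtain ⟨i, hi⟩ := hψ j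
          obtain ⟨i', hi'⟩ := hφ i
          exact ⟨i', by simp [hi, hi']⟩)
        have he : ∀ v, ev (fun i => Sum.elim Sum.inl ψ (φ i)) v = ev φ (ev ψ v) := by
          intro v; funext i; cases h : φ i <;> simp [ev, h]
        simp only [he] at hh
        exact hh

/-- evaluation with constants in the smaller alphabet -/
def evo (φ : ι → α ⊕ m) (x : m → Option α) (i : ι) : Option α := Sum.elim some x (φ i)

lemma ramsey [Finite α] (M₀ : Type) [Finite M₀] : ∀ (M C : Type) [Finite M] [Finite C],
    ∃ (N : Type) (_ : Finite N), ∀ c : (N → Option α) → C, ∃ φ : N → α ⊕ (M₀ ⊕ M), Pr φ ∧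
      ∀ z : M₀ → Option α, (∃ j, z j = none) → ∀ w w' : M → Option α,
        c (evo φ (Sum.elim z w)) = c (evo φ (Sum.elim z w')) := by
  induction M₀ using Finite.induction_empty_option with
  | of_equiv e ih =>
    rename_i P Q
    intro M C _ _
    obtain ⟨N, hN, H⟩ := ih M C
    refine ⟨N, hN, fun c => ?_⟩
    obtain ⟨φ, hφ, hc⟩ := H c
    refine ⟨fun i => Sum.map id (Sum.map e id) (φ i), fun j => ?_, fun z hz w w' => ?_⟩
    · rcases j with j | j
      · obtain ⟨i, hi⟩ := hφ (Sum.inl (e.symm j))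
        exact ⟨i, by simp [hi]⟩
      · obtain ⟨i, hi⟩ := hφ (Sum.inr j)
        exact ⟨i, by simp [hi]⟩
    · have key : ∀ w : M → Option α, evo (fun i => Sum.map id (Sum.map e id) (φ i)) (Sum.elim z w)
          = evo φ (Sum.elim (fun j => z (e j)) w) := by
        intro w
        funext i
        rcases h : φ i with a | j | j <;> simp [evo, h]
      rw [key, key]
      obtain ⟨j, hj⟩ := hz
      exact hc _ ⟨e.symm j, by simpa using hj⟩ w w'
  | h_empty =>
    intro M C _ _
    refine ⟨M, inferInstance, fun c => ⟨fun i => Sum.inr (Sum.inr i), ?_, ?_⟩⟩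
    · rintro (j | j)
      · exact j.elim
      · exact ⟨j, rfl⟩
    · rintro z ⟨j, -⟩
      exact j.elim
  | h_option ih =>
    rename_i P _
    intro M C _ _
    obtain ⟨N₁, hN₁, H⟩ := ih M (α → C)
    obtain ⟨ι, hι, HJ⟩ := Combinatorics.Subspace.exists_mono_in_high_dimension (Option α) C N₁
    refine ⟨Option ι, inferInstance, fun c => ?_⟩
    obtain ⟨l, c₀, hl⟩ := HJ (fun w => c (fun o => o.elim none w))
    let ψ : Option ι → α ⊕ Option N₁ := fun o => o.elim (Sum.inr none)
      (fun i => Sum.elim (fun q => q.elim (Sum.inr none) Sum.inl) (fun j => Sum.inr (some j))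
        (l.idxFun i))
    obtain ⟨φ₁, hφ₁, hc₁⟩ := H (fun y a => c (evo ψ (fun o => o.elim (some a) y)))
    let φ : Option ι → α ⊕ (Option P ⊕ M) := fun o =>
      Sum.elim Sum.inl (fun q => q.elim (Sum.inr (Sum.inl none))
        (fun j => Sum.map id (Sum.map some id) (φ₁ j))) (ψ o)
    have key : ∀ (z : Option P → Option α) (w : M → Option α), evo φ (Sum.elim z w) =
        evo ψ (fun o => o.elim (z none) (evo φ₁ (Sum.elim (fun j => z (some j)) w))) := by
      intro z w
      funext o
      rcases h : ψ o with a | _ | j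
      · simp [evo, φ, h]
      · simp [evo, φ, h]
      · rcases h' : φ₁ j with a | q | q <;> simp [evo, φ, h, h']
    have hψ : ∀ j : N₁, ∃ o, ψ o = Sum.inr (some j) := by
      intro j
      obtain ⟨i, hi⟩ := l.proper j
      exact ⟨some i, by simp [ψ, hi]⟩
    refine ⟨φ, ?_, fun z hz w w' => ?_⟩
    · rintro ((_ | j) | j)
      · exact ⟨none, by simp [φ, ψ]⟩
      · obtain ⟨i, hi⟩ := hφ₁ (Sum.inl j)
        obtain ⟨o, ho⟩ := hψ i
        exact ⟨o, by simp [φ, ho, hi]⟩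
      · obtain ⟨i, hi⟩ := hφ₁ (Sum.inr j)
        obtain ⟨o, ho⟩ := hψ i
        exact ⟨o, by simp [φ, ho, hi]⟩
    · rw [key, key]
      cases hz0 : z none with
      | none =>
        have h2 : ∀ y : N₁ → Option α, c (evo ψ (fun o => o.elim none y)) = c₀ := by
          intro y
          rw [← hl y]
          congr 1
          funext o
          rcases o with _ | i
          · simp [evo, ψ]
          · rcases h : l.idxFun i with (_ | a) | j <;>
              simp [evo, ψ, h, Combinatorics.Subspace.apply_def]
        rw [h2, h2]
      | some a =>
        obtain ⟨j, hj⟩ := hz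
        rcases j with _ | j
        · rw [hz0] at hj; cases hj
        · exact congrFun (hc₁ (fun j => z (some j)) ⟨j, hj⟩ w w') a

end cov
end SzProof

namespace SzProof
open Classical
set_option linter.unusedSectionVars false

lemma lower_of_avg {X : Type} [Finite X] [Nonempty X] {f : X → ℝ} {d ε : ℝ}
    (h1 : ∀ x, f x ≤ d + ε) (h2 : d - ε ≤ E f) (x : X) : d - 2 * ε * Nat.card X ≤ f x := by
  cases nonempty_fintype X
  have hpos : 0 < (Fintype.card X : ℝ) := by exact_mod_cast Fintype.card_pos
  have h3 : E (fun x => d + ε - f x) ≤ 2 * ε := by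
    rw [E_sub, E_const]; linarith
  rw [E_eq, div_le_iff₀ hpos] at h3
  have h4 : d + ε - f x ≤ ∑ x, (d + ε - f x) :=
    Finset.single_le_sum (f := fun x => d + ε - f x) (fun x _ => by linarith [h1 x])
      (Finset.mem_univ x)
  have h5 : 0 ≤ ε := by
    obtain ⟨y, hy⟩ := exists_ge h2
    linarith [h1 y]
  rw [Nat.card_eq_fintype_card]
  linarith

lemma evo_rp {ι α M₀ M : Type} (a : α) (φ : ι → α ⊕ (M₀ ⊕ M)) (x : M₀ ⊕ M → Option α) :
    rp a (evo φ x) = evo φ (rp a x) := by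
  funext i
  cases h : φ i <;> simp [rp, evo, h]

lemma good_mono {β : Type} [Finite β] {δ δ' : ℝ} (h : δ ≤ δ') (hg : Good β δ) : Good β δ' := by
  obtain ⟨ι, hι, H⟩ := hg
  exact ⟨ι, hι, fun A hA => H A (h.trans hA)⟩

theorem dhj_step {α : Type} [Finite α] [Nonempty α] (hα : DensHJ α) : DensHJ (Option α) := by
  by_contra hcon
  unfold DensHJ at hcon
  push Not at hcon
  obtain ⟨δ₀, hδ₀, hbad⟩ := hcon
  set S : Set ℝ := {δ | Good (Option α) δ} with hS
  have hlow : ∀ s ∈ S, δ₀ ≤ s := by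
    intro s hs
    by_contra! hlt
    exact hbad (good_mono hlt.le hs)
  have h2S : (2 : ℝ) ∈ S := by
    refine ⟨Empty, inferInstance, fun A hA => ?_⟩
    have := mu_le_one A
    linarith
  obtain ⟨d, hd⟩ : ∃ d, d = sInf S := ⟨_, rfl⟩
  have hd0 : 0 < d := by
    rw [hd]
    exact hδ₀.trans_le (le_csInf ⟨2, h2S⟩ hlow)
  have hup : ∀ ε > 0, Good (Option α) (d + ε) := by
    intro ε hε
    obtain ⟨s, hs, hlt⟩ := exists_lt_of_csInf_lt ⟨2, h2S⟩ (show sInf S < d + ε by linarith)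
    exact good_mono hlt.le hs
  have hdn : ∀ ε > 0, ¬ Good (Option α) (d - ε) := by
    intro ε hε hg
    have : sInf S ≤ d - ε := csInf_le ⟨δ₀, hlow⟩ hg
    linarith
  -- constants
  obtain ⟨M₀, hM₀, HM₀⟩ := hα (d / 2 / 2) (by positivity)
  obtain ⟨η, hη⟩ : ∃ η : ℝ, η = d / 2 / 2 / Nat.card (M₀ → Option α) := ⟨_, rfl⟩
  have hcM₀ : 0 < (Nat.card (M₀ → Option α) : ℝ) := by exact_mod_cast Nat.card_pos
  have hcM₀' : 1 ≤ (Nat.card (M₀ → Option α) : ℝ) := by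
    exact_mod_cast (Nat.card_pos : 0 < Nat.card (M₀ → Option α))
  have hη0 : 0 < η := by rw [hη]; positivity
  have hd1 : d ≤ 1 := by
    by_contra! hlt
    have h1S : (1 + d) / 2 ∈ S := by
      refine ⟨Empty, inferInstance, fun A hA => ?_⟩
      have := mu_le_one A
      linarith
    have : sInf S ≤ (1 + d) / 2 := csInf_le ⟨δ₀, hlow⟩ h1S
    linarith
  have hη1 : η ≤ 1 := by
    rw [hη, div_le_one hcM₀]; linarith
  obtain ⟨γ, hγ⟩ : ∃ γ : ℝ, γ = d * η / 4 := ⟨_, rfl⟩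
  have hγ0 : 0 < γ := by rw [hγ]; positivity
  have hγd : γ ≤ d / 2 := by rw [hγ]; nlinarith
  obtain ⟨m, hm, Hm⟩ := hup γ hγ0
  cases nonempty_fintype α
  obtain ⟨e, he⟩ : ∃ e : ℝ, e = γ / 2 / Fintype.card (Finset α) := ⟨_, rfl⟩
  have hcS : 0 < (Fintype.card (Finset α) : ℝ) := by exact_mod_cast Fintype.card_pos
  have he0 : 0 < e := by rw [he]; positivity
  obtain ⟨M, hM, HM⟩ := cov_multi (fun m _ => mdhj hα m) Finset.univ m e he0
  obtain ⟨N, hN, HN⟩ := ramsey (α := α) M₀ M Prop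
  have hcN : 0 < (Nat.card (N → Option α) : ℝ) := by exact_mod_cast Nat.card_pos
  obtain ⟨ε, hε⟩ : ∃ ε : ℝ, ε = γ / (2 * Nat.card (N → Option α)) := ⟨_, rfl⟩
  have hε0 : 0 < ε := by rw [hε]; positivity
  obtain ⟨Y, hY, HY⟩ := hup ε hε0
  obtain ⟨A, hA, hline⟩ : ∃ A : Set (N ⊕ Y → Option α), d - ε ≤ mu A ∧ ¬ HasLine A := by
    by_contra! hc
    exact hdn ε hε0 ⟨N ⊕ Y, inferInstance, hc⟩
  -- all sections are dense
  have hsec : ∀ x : N → Option α, d - γ ≤ mu {y : Y → Option α | Sum.elim x y ∈ A} := by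
    intro x
    have h1 : ∀ x : N → Option α, mu {y : Y → Option α | Sum.elim x y ∈ A} ≤ d + ε := by
      intro x
      by_contra! hlt
      refine hline (HasLine.pull (φ := Sum.elim (fun i => Sum.inl (x i)) Sum.inr)
        (fun j => ⟨Sum.inr j, rfl⟩) ?_)
      convert HY _ hlt.le using 1
      ext y
      have : ev (Sum.elim (fun i => Sum.inl (x i)) Sum.inr) y = Sum.elim x y := by
        funext i; cases i <;> simp [ev]
      simp [this]
    have h2 : d - ε ≤ E (fun x : N → Option α => mu {y : Y → Option α | Sum.elim x y ∈ A}) := by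
      rw [mu, E_words] at hA
      exact hA
    have h3 := lower_of_avg h1 h2 x
    have h4 : 2 * ε * Nat.card (N → Option α) = γ := by
      rw [hε]; field_simp
    rwa [h4] at h3
  obtain ⟨φ, hφ, hcol⟩ := HN (fun x => η ≤ mu {y : Y → Option α | ∀ a, Sum.elim (rp a x) y ∈ A})
  let w₀ : M → Option α := fun _ => some (Classical.arbitrary α)
  have hrow : d / 2 ≤ E (fun y : Y → Option α =>
      mu {x : M₀ → α | Sum.elim (evo φ (Sum.elim (fun j => some (x j)) w₀)) y ∈ A}) := by
    have h1 : E (fun y : Y → Option α =>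
        mu {x : M₀ → α | Sum.elim (evo φ (Sum.elim (fun j => some (x j)) w₀)) y ∈ A}) =
        E (fun x : M₀ → α => mu {y : Y → Option α |
          Sum.elim (evo φ (Sum.elim (fun j => some (x j)) w₀)) y ∈ A}) := E_comm _
    rw [h1]
    refine le_trans ?_ (E_mono (fun x => hsec _))
    rw [E_const]
    linarith
  obtain ⟨z, hz⟩ := pigeon _ (half_pos hd0) hrow
    (fun (l : M₀ → Option α) B => (∃ j, l j = none) ∧ ∀ b, (fun j => (l j).getD b) ∈ B)
    (fun y hB => HM₀ _ hB)
  rw [← hη] at hz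
  obtain ⟨_, hznone, -⟩ := mu_nonempty (hη0.trans_le hz)
  have hgood₀ : η ≤ mu {y : Y → Option α | ∀ a, Sum.elim (rp a (evo φ (Sum.elim z w₀))) y ∈ A} := by
    refine hz.trans (mu_mono ?_)
    rintro y ⟨-, hy⟩ a
    have := hy a
    rw [evo_rp]
    have h2 : rp a (Sum.elim z w₀) = Sum.elim (fun j => some ((z j).getD a)) w₀ := by
      funext i; cases i <;> simp [rp, w₀]
    rw [h2]
    exact this
  have hgood : ∀ w : M → Option α,
      η ≤ mu {y : Y → Option α | ∀ a, Sum.elim (rp a (evo φ (Sum.elim z w))) y ∈ A} :=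
    fun w => (hcol z hznone w₀ w).mp hgood₀
  -- choose y
  let A' : (Y → Option α) → Set (M → Option α) := fun y =>
    {w | Sum.elim (evo φ (Sum.elim z w)) y ∈ A}
  let Ca : (Y → Option α) → α → Set (M → Option α) := fun y a =>
    {w | Sum.elim (rp a (evo φ (Sum.elim z w))) y ∈ A}
  let C : (Y → Option α) → Set (M → Option α) := fun y => {w | ∀ a, w ∈ Ca y a}
  have hEA : d - γ ≤ E (fun y => mu (A' y)) := by
    have h1 : E (fun y => mu (A' y)) = E (fun w : M → Option α =>
        mu {y : Y → Option α | Sum.elim (evo φ (Sum.elim z w)) y ∈ A}) := E_comm _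
    rw [h1, ← E_const (X := M → Option α) (d - γ)]
    exact E_mono (fun w => hsec _)
  have hEC : η ≤ E (fun y => mu (C y)) := by
    have h1 : E (fun y => mu (C y)) = E (fun w : M → Option α =>
        mu {y : Y → Option α | ∀ a, Sum.elim (rp a (evo φ (Sum.elim z w))) y ∈ A}) := E_comm _
    rw [h1, ← E_const (X := M → Option α) η]
    exact E_mono (fun w => hgood w)
  have hE : γ ≤ E (fun y => mu (A' y) - (d + γ) * (1 - mu (C y))) := by
    rw [E_sub, E_mul, E_sub, E_const]
    nlinarith
  obtain ⟨y, hy⟩ := exists_ge hE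
  -- disjointness
  have hdisj : ∀ w, w ∈ A' y → w ∈ C y → False := by
    intro w hw1 hw2
    apply hline
    refine ⟨Sum.elim (fun n => (evo φ (Sum.elim z w) n).elim none (fun a => some (some a)))
      (fun i => some (y i)), ?_, ?_⟩
    · obtain ⟨j, hj⟩ := hznone
      obtain ⟨n, hn⟩ := hφ (Sum.inl j)
      exact ⟨Sum.inl n, by simp [evo, hn, hj]⟩
    · intro b
      cases b with
      | none =>
        have hw1' : Sum.elim (evo φ (Sum.elim z w)) y ∈ A := hw1
        convert hw1' using 1
        funext i
        rcases i with i | i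
        · cases h : evo φ (Sum.elim z w) i <;> simp [h]
        · simp
      | some a =>
        have hw2' : Sum.elim (rp a (evo φ (Sum.elim z w))) y ∈ A := hw2 a
        convert hw2' using 1
        funext i
        rcases i with i | i
        · cases h : evo φ (Sum.elim z w) i <;> simp [h, rp]
        · simp
  -- the test function
  let f : (M → Option α) → ℝ := fun w => ind (A' y) w - (d + γ)
  have hf1 : ∀ w, f w ≤ 1 := by
    intro w
    have := ind_le_one (A' y) w
    simp only [f]
    linarith
  have hf : ∀ ψ : M → Option α ⊕ m, Pr ψ → E (fun v => f (ev ψ v)) ≤ 0 := by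
    intro ψ hψ
    by_contra! hlt
    have h1 : E (fun v => f (ev ψ v)) = mu (ev ψ ⁻¹' A' y) - (d + γ) := by
      simp only [f]
      rw [E_sub, E_const]
      rfl
    rw [h1] at hlt
    have h2 : HasLine (A' y) := HasLine.pull hψ (Hm _ (by linarith))
    apply hline
    let χ : N ⊕ Y → Option α ⊕ M := Sum.elim
      (fun n => Sum.elim (fun a => Sum.inl (some a)) (Sum.elim (fun j => Sum.inl (z j)) Sum.inr) (φ n))
      (fun i => Sum.inl (y i))
    refine HasLine.pull (φ := χ) ?_ ?_
    · intro q
      obtain ⟨n, hn⟩ := hφ (Sum.inr q)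
      exact ⟨Sum.inl n, by simp [χ, hn]⟩
    · convert h2 using 1
      ext w
      have : ev χ w = Sum.elim (evo φ (Sum.elim z w)) y := by
        funext i
        rcases i with i | i
        · rcases h : φ i with a | j | j <;> simp [ev, χ, evo, h]
        · simp [ev, χ]
      simp [this, A']
  have hCains : ∀ a, Ins a (Ca y a) := by
    intro a w
    have : rp a (evo φ (Sum.elim z w)) = rp a (evo φ (Sum.elim z (rp a w))) := by
      rw [evo_rp, evo_rp, rp_elim_right]
    simp only [Ca, Set.mem_ofPred_eq, this]
  let D : Finset α → α → Set (M → Option α) := fun s a => if a ∈ s then Ca y a else (Ca y a)ᶜ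
  have hD : ∀ s a, Ins a (D s a) := by
    intro s a
    simp only [D]
    split_ifs
    · exact hCains a
    · exact (hCains a).compl
  have hcov : ∀ s, E (fun w => ind {w | ∀ a ∈ Finset.univ, w ∈ D s a} w * f w) ≤ e :=
    fun s => HM (D s) (hD s) f hf1 hf
  have hind : ∀ s w, ind {w | ∀ a ∈ Finset.univ, w ∈ D s a} w =
      if Finset.univ.filter (fun a => w ∈ Ca y a) = s then 1 else 0 := by
    intro s w
    unfold ind
    congr 1
    simp only [Finset.mem_univ, true_imp_iff, Set.mem_ofPred_eq, eq_iff_iff]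
    constructor
    · intro h
      ext a
      have := h a
      by_cases ha : a ∈ s
      · simpa [D, ha] using this
      · simpa [D, ha] using this
    · rintro rfl a
      by_cases ha : w ∈ Ca y a <;> simp [D, ha]
  have hpt : ∀ w, ∑ s ∈ Finset.univ.erase Finset.univ,
      ind {w | ∀ a ∈ Finset.univ, w ∈ D s a} w * f w =
      ind (A' y) w - (d + γ) * (1 - ind (C y) w) := by
    intro w
    simp only [hind, ite_mul, one_mul, zero_mul]
    rw [Finset.sum_ite_eq]
    by_cases hw : w ∈ C y
    · have h1 : Finset.univ.filter (fun a => w ∈ Ca y a) = Finset.univ := by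
        ext a; simpa using hw a
      have h2 : w ∉ A' y := fun h => hdisj w h hw
      simp [h1, ind, hw, h2]
    · have h1 : Finset.univ.filter (fun a => w ∈ Ca y a) ≠ Finset.univ := by
        intro h
        apply hw
        intro a
        have : a ∈ Finset.univ.filter (fun a => w ∈ Ca y a) := by rw [h]; simp
        simpa using this
      have h3 : ind (C y) w = 0 := by simp [ind, hw]
      rw [if_pos (by simpa using h1), h3]
      simp [f]
  have hsum : E (fun w => ind (A' y) w - (d + γ) * (1 - ind (C y) w)) ≤ γ / 2 := by
    simp only [← hpt]
    rw [E_sum]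
    refine (Finset.sum_le_sum (fun s _ => hcov s)).trans ?_
    rw [Finset.sum_const, nsmul_eq_mul]
    have h1 : ((Finset.univ.erase (Finset.univ : Finset α)).card : ℝ) ≤ Fintype.card (Finset α) := by
      exact_mod_cast Finset.card_le_univ _
    have h2 : (Fintype.card (Finset α) : ℝ) * e = γ / 2 := by
      rw [he]; field_simp
    nlinarith
  rw [E_sub, E_mul, E_sub, E_const] at hsum
  change mu (A' y) - (d + γ) * (1 - mu (C y)) ≤ γ / 2 at hsum
  linarith

lemma dhj_equiv {β γ : Type} [Finite β] [Finite γ] (e : β ≃ γ) (h : DensHJ β) : DensHJ γ := by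
  intro δ hδ
  obtain ⟨ι, hι, H⟩ := h δ hδ
  refine ⟨ι, hι, fun A hA => ?_⟩
  obtain ⟨l, ⟨j, hj⟩, hl⟩ := H {x | (fun i => e (x i)) ∈ A} (by
    refine hA.trans (le_of_eq ?_)
    exact (E_equiv (Equiv.arrowCongr (Equiv.refl ι) e) (ind A)).symm)
  refine ⟨fun i => (l i).map e, ⟨j, by simp [hj]⟩, fun c => ?_⟩
  have := hl (e.symm c)
  rw [Set.mem_ofPred_eq] at this
  convert this using 1
  funext i
  cases h : l i <;> simp [h]

theorem dhj_fin (k : ℕ) : DensHJ (Fin (k + 1)) := by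
  induction k with
  | zero =>
    intro δ hδ
    refine ⟨Unit, inferInstance, fun A hA => ?_⟩
    obtain ⟨x, hx⟩ := mu_nonempty (hδ.trans_le hA)
    refine ⟨fun _ => none, ⟨(), rfl⟩, fun b => ?_⟩
    convert hx using 1
    funext i
    exact Subsingleton.elim (α := Fin 1) _ _
  | succ k ih => exact dhj_equiv (finSuccEquiv (k + 1)).symm (dhj_step ih)

theorem szemeredi_aux (k : ℕ) (hk : 1 ≤ k) (δ : ℝ) (hδ0 : 0 < δ) (hδ1 : δ ≤ 1) :
    ∃ N₀ : ℕ, 1 ≤ N₀ ∧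
      ∀ N : ℕ, N₀ ≤ N →
        ∀ A : Finset ℕ, A ⊆ Finset.Icc 1 N → δ * (N : ℝ) ≤ (A.card : ℝ) →
          ∃ a r : ℕ, 1 ≤ r ∧ ∀ j < k, a + j * r ∈ A := by
  obtain ⟨k, rfl⟩ : ∃ k', k = k' + 1 := ⟨k - 1, by omega⟩
  obtain ⟨ι, hι, H⟩ := dhj_fin k (δ / 2) (half_pos hδ0)
  cases nonempty_fintype ι
  set n := Fintype.card ι with hn
  obtain ⟨N₁, hN₁⟩ := exists_nat_gt (2 * (n * (k + 1) : ℝ) / δ)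
  refine ⟨N₁ + 1, by omega, fun N hN A hA hcard => ?_⟩
  have hNpos : 0 < N := by omega
  have : Nonempty (Fin N) := ⟨⟨0, hNpos⟩⟩
  have hNr : (0 : ℝ) < N := by exact_mod_cast hNpos
  have hNbig : (n * (k + 1) : ℝ) ≤ δ / 2 * N := by
    have h1 : (N₁ : ℝ) ≤ N := by exact_mod_cast (by omega : N₁ ≤ N)
    rw [div_lt_iff₀ hδ0] at hN₁
    nlinarith
  have hshift : ∀ w : ι → Fin (k + 1),
      δ / 2 ≤ mu {x : Fin N | (x : ℕ) + 1 + ∑ i, (w i : ℕ) ∈ A} := by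
    intro w
    set s := ∑ i, (w i : ℕ) with hs
    have hsle : s ≤ n * (k + 1) := by
      calc s ≤ ∑ _i : ι, (k + 1) := Finset.sum_le_sum (fun i _ => (w i).2.le)
        _ = n * (k + 1) := by simp [hn]
    have hcount : A.card ≤ (Finset.univ.filter (fun x : Fin N => (x : ℕ) + 1 + s ∈ A)).card + s := by
      have hsub : A ⊆ ((Finset.univ.filter (fun x : Fin N => (x : ℕ) + 1 + s ∈ A)).image
          (fun x : Fin N => (x : ℕ) + 1 + s)) ∪ Finset.Icc 1 s := by
        intro a ha
        have h1 := Finset.mem_Icc.1 (hA ha)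
        rw [Finset.mem_union]
        by_cases has : a ≤ s
        · right; exact Finset.mem_Icc.2 ⟨h1.1, has⟩
        · left
          rw [Finset.mem_image]
          by_cases hs0 : a - s - 1 < N
          · refine ⟨⟨a - s - 1, hs0⟩, ?_, ?_⟩
            · simp only [Finset.mem_filter, Finset.mem_univ, true_and]
              rwa [show a - s - 1 + 1 + s = a by omega]
            · simp only
              omega
          · omega
      refine (Finset.card_le_card hsub).trans ((Finset.card_union_le _ _).trans ?_)
      rw [Nat.card_Icc, Nat.add_sub_cancel]
      gcongr
      exact Finset.card_image_le
    have hcount' : (A.card : ℝ) ≤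
        (Finset.univ.filter (fun x : Fin N => (x : ℕ) + 1 + s ∈ A)).card + n * (k + 1) := by
      exact_mod_cast hcount.trans (by gcongr)
    have hmu : mu {x : Fin N | (x : ℕ) + 1 + s ∈ A} =
        (Finset.univ.filter (fun x : Fin N => (x : ℕ) + 1 + s ∈ A)).card / N := by
      rw [mu, E_eq]
      congr 1
      · rw [Finset.card_filter]
        push_cast
        refine Finset.sum_congr rfl fun x _ => ?_
        by_cases hx : (x : ℕ) + 1 + s ∈ A <;> simp [ind, hx]
      · simp
    rw [hmu, le_div_iff₀ hNr]
    linarith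
  have hE : δ / 2 ≤ E (fun x : Fin N => mu {w : ι → Fin (k + 1) | (x : ℕ) + 1 + ∑ i, (w i : ℕ) ∈ A}) := by
    have h1 : E (fun x : Fin N => mu {w : ι → Fin (k + 1) | (x : ℕ) + 1 + ∑ i, (w i : ℕ) ∈ A}) =
      E (fun w : ι → Fin (k + 1) => mu {x : Fin N | (x : ℕ) + 1 + ∑ i, (w i : ℕ) ∈ A}) := E_comm _
    rw [h1, ← E_const (X := ι → Fin (k + 1)) (δ / 2)]
    exact E_mono hshift
  obtain ⟨x, hx⟩ := exists_ge hE
  obtain ⟨l, ⟨i₀, hi₀⟩, hl⟩ := H _ hx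
  refine ⟨x + 1 + ∑ i, ((l i).elim 0 (fun c => (c : ℕ))), (Finset.univ.filter (fun i => l i = none)).card,
    Finset.card_pos.2 ⟨i₀, by simpa using hi₀⟩, fun j hj => ?_⟩
  have := hl ⟨j, hj⟩
  rw [Set.mem_ofPred_eq] at this
  convert this using 1
  rw [add_assoc, Finset.card_filter, Finset.mul_sum, ← Finset.sum_add_distrib]
  congr 1
  refine Finset.sum_congr rfl fun i _ => ?_
  cases h : l i <;> simp [h]

end SzProof

/-- **Szemerédi's theorem.**  For any integer `k ≥ 1` and real `0 < δ ≤ 1` there exists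
`N_SZ(k,δ) ≥ 1` such that for every `N ≥ N_SZ(k,δ)`, every `A ⊆ {1,…,N}` with `|A| ≥ δN`
contains a proper arithmetic progression `a, a+r, …, a+(k-1)r` (with `r ≥ 1`) of length `k`. -/
theorem szemeredi (k : ℕ) (hk : 1 ≤ k) (δ : ℝ) (hδ0 : 0 < δ) (hδ1 : δ ≤ 1) :
    ∃ N₀ : ℕ, 1 ≤ N₀ ∧
      ∀ N : ℕ, N₀ ≤ N →
        ∀ A : Finset ℕ, A ⊆ Finset.Icc 1 N → δ * (N : ℝ) ≤ (A.card : ℝ) →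
          ∃ a r : ℕ, 1 ≤ r ∧ ∀ j < k, a + j * r ∈ A := by
  exact SzProof.szemeredi_aux k hk δ hδ0 hδ1
end

section
/- For every integer k ≥ 1 and real 0 < δ ≤ 1 there exist a constant c(k,δ) > 0 and an integer N₀(k,δ) such that for every prime N ≥ N₀(k,δ) and every function f: Z_N → [0,1] with E(f | Z_N) ≥ δ, one has E( ∏_{j=0}^{k-1} f(x + jr) | x, r ∈ Z_N ) ≥ c(k,δ). -/
namespace Sz

open Combinatorics

/-- Average of a real function over a finite type. -/
noncomputable def av {X : Type} [Finite X] (f : X → ℝ) : ℝ :=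
  letI := Fintype.ofFinite X
  (∑ x, f x) / (Fintype.card X : ℝ)

open Classical in
/-- Real indicator of a proposition. -/
noncomputable def ind (p : Prop) : ℝ := if p then 1 else 0

theorem ind_true {p : Prop} (h : p) : ind p = 1 := by simp [ind, h]
theorem ind_false {p : Prop} (h : ¬ p) : ind p = 0 := by simp [ind, h]
theorem ind_nonneg (p : Prop) : 0 ≤ ind p := by unfold ind; split_ifs <;> norm_num
theorem ind_le_one (p : Prop) : ind p ≤ 1 := by unfold ind; split_ifs <;> norm_num
theorem ind_mono {p q : Prop} (h : p → q) : ind p ≤ ind q := by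
  by_cases hp : p
  · rw [ind_true hp, ind_true (h hp)]
  · rw [ind_false hp]; exact ind_nonneg q

section
variable {X Y : Type} [Finite X] [Finite Y]

theorem av_eq [Fintype X] (f : X → ℝ) : av f = (∑ x, f x) / (Fintype.card X : ℝ) := by
  unfold av
  congr!

theorem av_mono {f g : X → ℝ} (h : ∀ x, f x ≤ g x) : av f ≤ av g := by
  cases nonempty_fintype X
  rw [av_eq, av_eq]
  gcongr
  exact h _

theorem av_congr {f g : X → ℝ} (h : ∀ x, f x = g x) : av f = av g := by
  rw [funext h]

theorem av_add (f g : X → ℝ) : av (fun x => f x + g x) = av f + av g := by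
  cases nonempty_fintype X
  simp only [av_eq, Finset.sum_add_distrib, add_div]

theorem av_sub (f g : X → ℝ) : av (fun x => f x - g x) = av f - av g := by
  cases nonempty_fintype X
  simp only [av_eq, Finset.sum_sub_distrib, sub_div]

theorem av_mul_left (c : ℝ) (f : X → ℝ) : av (fun x => c * f x) = c * av f := by
  cases nonempty_fintype X
  simp only [av_eq, ← Finset.mul_sum, mul_div_assoc]

theorem av_const [Nonempty X] (c : ℝ) : av (fun _ : X => c) = c := by
  cases nonempty_fintype X
  have : (Fintype.card X : ℝ) ≠ 0 := by positivity
  simp [av_eq]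

theorem av_nonneg {f : X → ℝ} (h : ∀ x, 0 ≤ f x) : 0 ≤ av f := by
  cases nonempty_fintype X
  rw [av_eq]
  have := Finset.sum_nonneg (s := Finset.univ) (fun x _ => h x)
  positivity

theorem av_le_of_le [Nonempty X] {f : X → ℝ} {c : ℝ} (h : ∀ x, f x ≤ c) : av f ≤ c := by
  rw [← av_const (X := X) c]; exact av_mono h

theorem le_av_of_le [Nonempty X] {f : X → ℝ} {c : ℝ} (h : ∀ x, c ≤ f x) : c ≤ av f := by
  rw [← av_const (X := X) c]; exact av_mono h

theorem exists_of_le_av [Nonempty X] {f : X → ℝ} {c : ℝ} (h : c ≤ av f) : ∃ x, c ≤ f x := by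
  cases nonempty_fintype X
  rw [av_eq] at h
  have hc : (0 : ℝ) < Fintype.card X := by positivity
  rw [le_div_iff₀ hc] at h
  obtain ⟨x, -, hx⟩ := Finset.exists_le_of_sum_le (s := Finset.univ) (f := fun _ : X => c) (g := f)
    Finset.univ_nonempty (by simpa [mul_comm] using h)
  exact ⟨x, hx⟩

theorem av_equiv (e : X ≃ Y) (f : Y → ℝ) : av (fun x => f (e x)) = av f := by
  cases nonempty_fintype X
  cases nonempty_fintype Y
  rw [av_eq, av_eq, Fintype.card_congr e, Equiv.sum_comp e f]

theorem av_prod (f : X × Y → ℝ) : av f = av (fun x => av (fun y => f (x, y))) := by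
  cases nonempty_fintype X
  cases nonempty_fintype Y
  simp only [av_eq, Fintype.sum_prod_type, Fintype.card_prod, ← Finset.sum_div]
  push_cast
  rw [div_div, mul_comm]

theorem av_comm (f : X → Y → ℝ) :
    av (fun x => av (fun y => f x y)) = av (fun y => av (fun x => f x y)) := by
  rw [← av_prod (fun p : X × Y => f p.1 p.2), ← av_prod (fun p : Y × X => f p.2 p.1)]
  exact av_equiv (Equiv.prodComm X Y) (fun p : Y × X => f p.2 p.1)

theorem av_sum {I : Type} (s : Finset I) (f : I → X → ℝ) :
    av (fun x => ∑ i ∈ s, f i x) = ∑ i ∈ s, av (f i) := by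
  cases nonempty_fintype X
  simp only [av_eq]
  rw [Finset.sum_comm, Finset.sum_div]

theorem le_card_mul_av {f : X → ℝ} (h : ∀ x, 0 ≤ f x) (x : X) : f x ≤ Nat.card X * av f := by
  cases nonempty_fintype X
  haveI : Nonempty X := ⟨x⟩
  have hc : (0 : ℝ) < Fintype.card X := by positivity
  rw [av_eq, Nat.card_eq_fintype_card, mul_div_cancel₀ _ hc.ne']
  exact Finset.single_le_sum (fun y _ => h y) (Finset.mem_univ x)

/-- Reverse Markov. -/
theorem markov [Nonempty X] {f : X → ℝ} {c : ℝ} (h1 : ∀ x, f x ≤ 1) (hc0 : 0 ≤ c)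
    (hc : c ≤ av f) : c / 2 ≤ av (fun x => ind (c / 2 ≤ f x)) := by
  have : av f ≤ av (fun x => ind (c / 2 ≤ f x)) + c / 2 := by
    rw [← av_const (X := X) (c / 2), ← av_add, av_const]
    apply av_mono
    intro x
    by_cases hx : c / 2 ≤ f x
    · rw [ind_true hx]; linarith [h1 x]
    · rw [ind_false hx]; linarith
  linarith

/-- Pigeonhole. -/
theorem pigeon [Nonempty Y] {L : Type} [Finite L] {δ : ℝ} (hδ : 0 < δ) (A : X → Y → Prop)
    (R : L → Y → Prop) (hA : δ ≤ av (fun y => av (fun x => ind (A x y))))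
    (h : ∀ y, δ / 2 ≤ av (fun x => ind (A x y)) → ∃ l, R l y) :
    ∃ l, δ / 2 / Nat.card L ≤ av (fun y => ind (R l y)) := by
  cases nonempty_fintype L
  have hX : Nonempty X := by
    by_contra hX
    rw [not_nonempty_iff] at hX
    have : ∀ f : X → ℝ, av f = 0 := by
      intro f; cases nonempty_fintype X; simp [av_eq]
    simp only [this] at hA
    rw [av_const] at hA
    linarith
  have h1 := markov (f := fun y => av (fun x => ind (A x y)))
    (fun y => av_le_of_le fun x => ind_le_one _) hδ.le hA
  have h2 : av (fun y => ind (δ / 2 ≤ av (fun x => ind (A x y))))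
      ≤ ∑ l : L, av (fun y => ind (R l y)) := by
    rw [← av_sum]
    apply av_mono
    intro y
    by_cases hy : δ / 2 ≤ av (fun x => ind (A x y))
    · obtain ⟨l, hl⟩ := h y hy
      rw [ind_true hy, ← ind_true hl]
      exact Finset.single_le_sum (f := fun l => ind (R l y)) (fun l _ => ind_nonneg _)
        (Finset.mem_univ l)
    · rw [ind_false hy]
      exact Finset.sum_nonneg fun l _ => ind_nonneg _
  have hL : Nonempty L := by
    by_contra hL
    rw [not_nonempty_iff] at hL
    simp at h2
    linarith
  have h3 : δ / 2 ≤ av (fun l : L => Nat.card L * av (fun y => ind (R l y))) := by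
    have hc : (Fintype.card L : ℝ) ≠ 0 := by positivity
    rw [av_mul_left, av_eq, Nat.card_eq_fintype_card, mul_div_cancel₀ _ hc]
    linarith
  obtain ⟨l, hl⟩ := exists_of_le_av h3
  refine ⟨l, ?_⟩
  have hc : (0 : ℝ) < Nat.card L := by rw [Nat.card_eq_fintype_card]; positivity
  rw [div_le_iff₀ hc]
  linarith

/-- Independence. -/
theorem av_indep {I O : Type} [Fintype I] [Finite O] (f : I → O → ℝ) :
    av (fun x : I → O => ∏ i, f i (x i)) = ∏ i, av (f i) := by
  classical
  cases nonempty_fintype O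
  simp only [av_eq]
  rw [Finset.prod_div_distrib, Finset.prod_univ_sum, Fintype.piFinset_univ]
  simp

theorem ind_forall {I : Type} [Fintype I] (p : I → Prop) : ind (∀ i, p i) = ∏ i, ind (p i) := by
  by_cases h : ∀ i, p i
  · rw [ind_true h, Finset.prod_eq_one fun i _ => ind_true (h i)]
  · rw [ind_false h]
    push Not at h
    obtain ⟨i, hi⟩ := h
    exact (Finset.prod_eq_zero (Finset.mem_univ i) (ind_false hi)).symm

/-- Resampling the coordinates in the range of `e`. -/
theorem av_extend {I K O : Type} [Finite I] [Finite K] [Finite O] [Nonempty O] (e : K → I)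
    (he : Function.Injective e) (F : (I → O) → ℝ) :
    av (fun x => av (fun z : K → O => F (Function.extend e z x))) = av F := by
  have h1 : av F = av (fun x => av (fun _ : K → O => F x)) := by
    simp only [av_const]
  rw [h1, ← av_prod (fun p : (I → O) × (K → O) => F (Function.extend e p.2 p.1)),
    ← av_prod (fun p : (I → O) × (K → O) => F p.1)]
  have hinv : Function.Involutive
      (fun p : (I → O) × (K → O) => (Function.extend e p.2 p.1, p.1 ∘ e)) := by
    rintro ⟨x, z⟩
    refine Prod.ext ?_ ?_
    · funext i
      by_cases hi : ∃ j, e j = i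
      · obtain ⟨j, rfl⟩ := hi
        simp [he.extend_apply]
      · simp [Function.extend_apply' _ _ _ hi]
    · funext j
      simp [he.extend_apply]
  exact av_equiv hinv.toPerm (fun p : (I → O) × (K → O) => F p.1)

end

theorem av_sumElim {I J O : Type} [Finite I] [Finite J] [Finite O] (F : (I ⊕ J → O) → ℝ) :
    av F = av (fun x : I → O => av (fun y : J → O => F (Sum.elim x y))) := by
  rw [← av_prod (fun p : (I → O) × (J → O) => F (Sum.elim p.1 p.2))]
  exact (av_equiv (Equiv.sumArrowEquivProdArrow I J O).symm F).symm

end Sz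

namespace Sz

open Combinatorics

instance lineFinite (α ι : Type) [Finite α] [Finite ι] : Finite (Line α ι) :=
  Finite.of_injective (fun l : Line α ι => l.idxFun) fun _ _ h => Line.ext h

/-- Composition of subspaces. -/
def scomp {ζ η α ι : Type} (V : Subspace η α ι) (W : Subspace ζ α η) : Subspace ζ α ι where
  idxFun i := (V.idxFun i).elim Sum.inl W.idxFun
  proper e := by
    obtain ⟨j, hj⟩ := W.proper e
    obtain ⟨i, hi⟩ := V.proper j
    exact ⟨i, by simp [hi, hj]⟩

theorem scomp_apply {ζ η α ι : Type} (V : Subspace η α ι) (W : Subspace ζ α η) (x : ζ → α) :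
    scomp V W x = V (W x) := by
  funext i
  simp only [Subspace.coe_apply, scomp]
  cases V.idxFun i <;> simp [Subspace.coe_apply]

/-- Image of a line under a subspace. -/
def sline {η α ι : Type} (V : Subspace η α ι) (l : Line α η) : Line α ι where
  idxFun i := (V.idxFun i).elim some l.idxFun
  proper := by
    obtain ⟨j, hj⟩ := l.proper
    obtain ⟨i, hi⟩ := V.proper j
    exact ⟨i, by simp [hi, hj]⟩

theorem sline_apply {η α ι : Type} (V : Subspace η α ι) (l : Line α η) (a : α) :
    sline V l a = V (l a) := by
  funext i
  simp only [Subspace.coe_apply, sline, Line.coe_apply]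
  cases V.idxFun i <;> simp

/-- Extend the alphabet of a subspace by one letter. -/
def opt {η α ι : Type} (V : Subspace η α ι) : Subspace η (Option α) ι where
  idxFun i := (V.idxFun i).map some id
  proper e := by
    obtain ⟨i, hi⟩ := V.proper e
    exact ⟨i, by simp [hi]⟩

theorem opt_some {η α ι : Type} (V : Subspace η α ι) (x : η → α) :
    opt V (fun i => some (x i)) = fun i => some (V x i) := by
  funext i
  simp only [Subspace.coe_apply, opt]
  cases V.idxFun i <;> simp

theorem subspace_injective {η α ι : Type} (V : Subspace η α ι) :
    Function.Injective (fun x : η → α => V x) := by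
  intro x y h
  funext e
  obtain ⟨i, hi⟩ := V.proper e
  have := congrFun h i
  simpa [Subspace.coe_apply, hi] using this

/-- Embed a subspace in the coordinates `e`, with the others fixed by `x`. -/
noncomputable def semb {η α κ ι : Type} (e : κ → ι) (he : Function.Injective e) (x : ι → α)
    (V : Subspace η α κ) : Subspace η α ι where
  idxFun := Function.extend e V.idxFun (fun i => Sum.inl (x i))
  proper t := by
    obtain ⟨i, hi⟩ := V.proper t
    exact ⟨e i, by simp [he.extend_apply, hi]⟩

theorem semb_apply {η α κ ι : Type} (e : κ → ι) (he : Function.Injective e) (x : ι → α)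
    (V : Subspace η α κ) (v : η → α) : semb e he x V v = Function.extend e (V v) x := by
  funext i
  simp only [Subspace.coe_apply, semb]
  by_cases hi : ∃ j, e j = i
  · obtain ⟨j, rfl⟩ := hi
    simp [he.extend_apply, Subspace.coe_apply]
  · simp [Function.extend_apply' _ _ _ hi]

/-- Density Hales-Jewett at density `δ`. -/
def DHJat (α : Type) [Finite α] (δ : ℝ) : Prop :=
  ∃ (ι : Type) (_ : Finite ι), ∀ A : Set (ι → α), δ ≤ av (fun x => ind (x ∈ A)) →
    ∃ l : Line α ι, ∀ a, l a ∈ A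

theorem mdhj {α : Type} [Finite α] [Nonempty α] (h : ∀ δ : ℝ, 0 < δ → DHJat α δ) (m : ℕ) :
    ∀ δ : ℝ, 0 < δ → ∃ (ι : Type) (_ : Finite ι), ∀ A : Set (ι → α),
      δ ≤ av (fun x => ind (x ∈ A)) → ∃ V : Subspace (Fin m) α ι, ∀ x, V x ∈ A := by
  induction m with
  | zero =>
    intro δ hδ
    refine ⟨Unit, inferInstance, fun A hA => ?_⟩
    obtain ⟨x, hx⟩ := exists_of_le_av hA
    have hxA : x ∈ A := by
      by_contra hxA
      rw [ind_false hxA] at hx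
      linarith
    refine ⟨⟨fun i => Sum.inl (x i), fun e => e.elim0⟩, fun y => ?_⟩
    exact hxA
  | succ m ih =>
    intro δ hδ
    obtain ⟨ι₁, _, h₁⟩ := h (δ / 2) (by positivity)
    by_cases hL : Nonempty (Line α ι₁)
    swap
    · refine ⟨ι₁, inferInstance, fun A hA => ?_⟩
      obtain ⟨l, -⟩ := h₁ A (by linarith)
      exact absurd ⟨l⟩ hL
    have hLc : 0 < (Nat.card (Line α ι₁) : ℝ) := by
      exact_mod_cast Nat.card_pos
    obtain ⟨ι₂, _, h₂⟩ := ih (δ / 2 / Nat.card (Line α ι₁)) (by positivity)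
    refine ⟨ι₁ ⊕ ι₂, inferInstance, fun A hA => ?_⟩
    rw [av_sumElim, av_comm] at hA
    obtain ⟨l, hl⟩ := pigeon (L := Line α ι₁) hδ
      (fun (x : ι₁ → α) (y : ι₂ → α) => Sum.elim x y ∈ A)
      (fun l y => ∀ a, Sum.elim (l a) y ∈ A) hA
      (fun y hy => h₁ {x | Sum.elim x y ∈ A} hy)
    obtain ⟨V, hV⟩ := h₂ {y | ∀ a, Sum.elim (l a) y ∈ A} hl
    refine ⟨⟨Sum.elim (fun i => (l.idxFun i).elim (Sum.inr 0) Sum.inl)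
      (fun i => (V.idxFun i).map id Fin.succ), ?_⟩, ?_⟩
    · intro e
      refine Fin.cases ?_ (fun e => ?_) e
      · obtain ⟨i, hi⟩ := l.proper
        exact ⟨Sum.inl i, by simp [hi]⟩
      · obtain ⟨i, hi⟩ := V.proper e
        exact ⟨Sum.inr i, by simp [hi]⟩
    · intro x
      have := hV (fun i => x i.succ) (x 0)
      convert this using 1
      funext i
      rcases i with i | i
      · simp only [Subspace.coe_apply, Sum.elim_inl, Line.coe_apply]
        cases l.idxFun i <;> simp
      · simp only [Subspace.coe_apply, Sum.elim_inr]
        cases V.idxFun i <;> simp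

theorem mdhj' {α : Type} [Finite α] [Nonempty α] (h : ∀ δ : ℝ, 0 < δ → DHJat α δ) (m : ℕ)
    (δ : ℝ) (hδ : 0 < δ) : ∃ (κ : Type) (_ : Finite κ), ∀ (ι : Type) [Finite ι] (e : κ → ι)
      (_ : Function.Injective e) (A : Set (ι → α)),
      δ ≤ av (fun x => ind (x ∈ A)) → ∃ V : Subspace (Fin m) α ι, (∀ x, V x ∈ A) ∧
        ∀ i t, V.idxFun i = Sum.inr t → ∃ j, e j = i := by
  obtain ⟨κ, _, hκ⟩ := mdhj h m δ hδ
  refine ⟨κ, inferInstance, fun ι _ e he A hA => ?_⟩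
  rw [← av_extend e he] at hA
  obtain ⟨x, hx⟩ := exists_of_le_av hA
  obtain ⟨V, hV⟩ := hκ {z | Function.extend e z x ∈ A} hx
  refine ⟨semb e he x V, fun v => ?_, fun i t hi => ?_⟩
  · rw [semb_apply]; exact hV v
  · by_contra hc
    simp [semb, Function.extend_apply' _ _ _ hc] at hi

/-- Graham-Rothschild for lines, first form. -/
theorem gr_aux (α κ : Type) [Finite α] [Finite κ] [Nonempty α] (d : ℕ) :
    ∃ (ι : Type) (_ : Finite ι), ∀ c : (ι → Option α) → κ,
      ∃ (V : Subspace (Fin d) α ι) (f : Fin d → κ), ∀ (j : Fin d) (v : Fin d → Option α),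
        v j = none → (∀ i < j, v i ≠ none) → c (opt V v) = f j := by
  induction d with
  | zero =>
    refine ⟨Unit, inferInstance, fun c => ?_⟩
    exact ⟨⟨fun _ => Sum.inl (Classical.arbitrary α), fun e => e.elim0⟩, fun e => e.elim0,
      fun e => e.elim0⟩
  | succ d ih =>
    obtain ⟨ι', _, h'⟩ := ih
    obtain ⟨ι₁, _, h₁⟩ := Subspace.exists_mono_in_high_dimension α κ ι'
    obtain ⟨ι₂, _, h₂⟩ := Line.exists_mono_in_high_dimension (α ⊕ ι₁) ((ι₁ → Option α) → κ)
    refine ⟨ι₁ ⊕ ι₂, inferInstance, fun c => ?_⟩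
    obtain ⟨Z, col, hZ⟩ := h₂ (fun z u => c (Sum.elim u (fun i => (z i).elim some u)))
    let S : (ι₁ → Option α) → Option α → (ι₂ → Option α) := fun u s i =>
      (Z.idxFun i).elim s (fun t => t.elim some u)
    have hS : ∀ (u : ι₁ → Option α) (t : α ⊕ ι₁),
        c (Sum.elim u (S u (t.elim some u))) = col u := by
      intro u t
      rw [← hZ t]
      congr 2
      funext i
      simp only [S, Line.coe_apply]
      cases Z.idxFun i <;> simp
    obtain ⟨U, f0, hU⟩ := h₁ (fun u => c (Sum.elim (fun i => some (u i))
      (S (fun i => some (u i)) none)))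
    obtain ⟨V', f, hV'⟩ := h' (fun u' => col (opt U u'))
    let W := scomp U V'
    let V : Subspace (Fin (d + 1)) α (ι₁ ⊕ ι₂) :=
      { idxFun := Sum.elim (fun i => (W.idxFun i).map id Fin.castSucc)
          (fun i => (Z.idxFun i).elim (Sum.inr (Fin.last d))
            (fun t => t.elim Sum.inl (fun j => (W.idxFun j).map id Fin.castSucc)))
        proper := by
          intro e
          refine Fin.lastCases ?_ (fun e => ?_) e
          · obtain ⟨i, hi⟩ := Z.proper
            exact ⟨Sum.inr i, by simp [hi]⟩
          · obtain ⟨i, hi⟩ := W.proper e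
            exact ⟨Sum.inl i, by simp [hi]⟩ }
    have hV : ∀ v, opt V v = Sum.elim (opt W (fun i => v i.castSucc))
        (S (opt W (fun i => v i.castSucc)) (v (Fin.last d))) := by
      intro v
      funext i
      rcases i with i | i
      · simp only [Subspace.coe_apply, opt, V, Sum.elim_inl]
        cases W.idxFun i <;> simp
      · simp only [Subspace.coe_apply, opt, V, Sum.elim_inr, S]
        rcases Z.idxFun i with _ | (a | j)
        · simp
        · simp
        · simp only [Option.elim_some, Sum.elim_inr, Subspace.coe_apply]
          cases W.idxFun j <;> simp
    have hW : ∀ v, opt W v = opt U (opt V' v) := by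
      intro v
      funext i
      simp only [Subspace.coe_apply, opt, W, scomp]
      rcases U.idxFun i with a | j
      · simp
      · simp [Subspace.coe_apply]
    refine ⟨V, Fin.snoc f f0, fun j v => ?_⟩
    refine Fin.lastCases ?_ (fun j => ?_) j
    · intro hj hlt
      rw [Fin.snoc_last, hV, hj]
      have : ∀ i : Fin d, ∃ a, v i.castSucc = some a := fun i =>
        Option.ne_none_iff_exists'.1 (hlt _ (Fin.castSucc_lt_last i))
      choose w hw using this
      have hw' : (fun i : Fin d => v i.castSucc) = fun i => some (w i) := funext hw
      rw [hw', hW, opt_some, opt_some]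
      exact hU (V' w)
    · intro hj hlt
      rw [Fin.snoc_castSucc, hV]
      have h3 := hV' j (fun i => v i.castSucc) hj (fun i hi => hlt _ (by simpa using hi))
      rw [← h3, ← hW]
      obtain ⟨i0, hi0⟩ := W.proper j
      have hu : opt W (fun i => v i.castSucc) i0 = none := by
        simp [Subspace.coe_apply, opt, hi0, hj]
      rcases hl : v (Fin.last d) with _ | a
      · have := hS (opt W (fun i => v i.castSucc)) (Sum.inr i0)
        rwa [Sum.elim_inr, hu] at this
      · exact hS (opt W (fun i => v i.castSucc)) (Sum.inl a)

theorem gr (α κ : Type) [Finite α] [Finite κ] [Nonempty κ] [Nonempty α] (d : ℕ) :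
    ∃ (ι : Type) (_ : Finite ι), ∀ c : (ι → Option α) → κ,
      ∃ (V : Subspace (Fin d) α ι) (c0 : κ), ∀ (v : Fin d → Option α),
        (∃ j, v j = none) → c (opt V v) = c0 := by
  classical
  cases nonempty_fintype κ
  obtain ⟨ι, _, h⟩ := gr_aux α κ (Fintype.card κ * d)
  refine ⟨ι, inferInstance, fun c => ?_⟩
  obtain ⟨V, f, hV⟩ := h c
  obtain ⟨c0, hc0⟩ := Fintype.exists_le_card_fiber_of_mul_le_card f (n := d) (by simp)
  let e := Finset.orderEmbOfCardLe _ hc0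
  have he : ∀ i, f (e i) = c0 := fun i => by
    have := Finset.orderEmbOfCardLe_mem _ hc0 i
    simpa using this
  have hinj : Function.Injective e := e.injective
  let a0 : α := Classical.arbitrary α
  let E : Subspace (Fin d) α (Fin (Fintype.card κ * d)) :=
    semb e hinj (fun _ => a0) ⟨Sum.inr, fun i => ⟨i, rfl⟩⟩
  refine ⟨scomp V E, c0, fun v hv => ?_⟩
  have h1 : opt (scomp V E) v = opt V (Function.extend e v (fun _ => some a0)) := by
    funext i
    simp only [Subspace.coe_apply, opt, scomp]
    rcases V.idxFun i with a | j
    · simp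
    · simp only [E, semb, Sum.elim_inr, Sum.map_inr, id]
      by_cases hj : ∃ t, e t = j
      · obtain ⟨t, rfl⟩ := hj
        simp [hinj.extend_apply]
      · simp [Function.extend_apply' _ _ _ hj]
  rw [h1]
  set v' := Function.extend e v (fun _ => some a0) with hv'
  have hex : ∃ j, v' j = none := by
    obtain ⟨j, hj⟩ := hv
    exact ⟨e j, by rw [hv', hinj.extend_apply, hj]⟩
  obtain ⟨j, hj, hmin⟩ := WellFounded.has_min (wellFounded_lt (α := Fin (Fintype.card κ * d)))
    {j | v' j = none} hex
  have hj' : ∃ t, e t = j := by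
    by_contra hc
    have : v' j = none := hj
    rw [hv', Function.extend_apply' _ _ _ hc] at this
    simp at this
  obtain ⟨t, rfl⟩ := hj'
  rw [hV (e t) v' hj (fun i hi hc => hmin i hc hi), he]

end Sz

namespace Sz

open Combinatorics

/-- `E` does not distinguish `none` and `some a` in the coordinates in `J`. -/
def Ins {α ι : Type} (a : α) (J : Set ι) (E : Set (ι → Option α)) : Prop :=
  ∀ x y, x ∈ E → (∀ i, x i = y i ∨ (i ∈ J ∧ (x i).getD a = (y i).getD a)) → y ∈ E

theorem av_mask {α ι : Type} [Finite α] [Finite ι] [Nonempty α] (F : (ι → Option α) → ℝ) :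
    av (fun x : ι → Option α => av (fun z : ι → α => F (fun i => (x i).map (fun _ => z i)))) = av F := by
  have h1 : av F = av (fun x => av (fun _ : ι → α => F x)) := by
    simp only [av_const]
  rw [h1, ← av_prod (fun p : (ι → Option α) × (ι → α) => F (fun i => (p.1 i).map (fun _ => p.2 i))),
    ← av_prod (fun p : (ι → Option α) × (ι → α) => F p.1)]
  have hinv : Function.Involutive
      (fun p : (ι → Option α) × (ι → α) =>
        ((fun i => (p.1 i).map (fun _ => p.2 i)), (fun i => (p.1 i).getD (p.2 i)))) := by
    rintro ⟨x, z⟩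
    refine Prod.ext ?_ ?_
    · funext i
      rcases h : x i with _ | b <;> simp [h]
    · funext i
      rcases h : x i with _ | b <;> simp [h]
  exact av_equiv hinv.toPerm (fun p : (ι → Option α) × (ι → α) => F p.1)

theorem av_ind_eq {O : Type} [Finite O] (o : O) : av (fun x : O => ind (x = o)) = 1 / Nat.card O := by
  classical
  cases nonempty_fintype O
  rw [av_eq, Nat.card_eq_fintype_card]
  simp [ind]

theorem av_row {κ O : Type} [Finite κ] [Finite O] [Nonempty O] (b : ℕ) (r : κ) (o : O) :
    av (fun x : κ × Fin b → O => ind (∀ s, x (r, s) = o)) = (1 / Nat.card O : ℝ) ^ b := by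
  classical
  cases nonempty_fintype κ
  have h1 : ∀ x : κ × Fin b → O, ind (∀ s, x (r, s) = o) =
      ∏ i : κ × Fin b, (if i.1 = r then ind (x i = o) else 1) := by
    intro x
    rw [Fintype.prod_prod_type, Finset.prod_eq_single r]
    · simp [ind_forall]
    · intro r' _ hr'
      simp [hr']
    · simp
  rw [av_congr h1, av_indep (fun (i : κ × Fin b) (y : O) => if i.1 = r then ind (y = o) else 1),
    Fintype.prod_prod_type, Finset.prod_eq_single r]
  · simp [av_ind_eq]
  · intro r' _ hr'
    simp [hr', av_const]
  · simp

theorem dense_ins {α : Type} [Finite α] [Nonempty α] (h : ∀ δ : ℝ, 0 < δ → DHJat α δ) (a : α)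
    (m : ℕ) (β : ℝ) (hβ : 0 < β) : ∃ (κ : Type) (_ : Finite κ), ∀ E : Set (κ → Option α),
      Ins a Set.univ E → β ≤ av (fun x => ind (x ∈ E)) →
      ∃ W : Subspace (Fin m) (Option α) κ, ∀ x, W x ∈ E := by
  classical
  obtain ⟨κ₀, _, h₀⟩ := mdhj' h m (β / 2) (by positivity)
  cases nonempty_fintype κ₀
  cases nonempty_fintype α
  have hq : (1 / Nat.card (Option α) : ℝ) < 1 := by
    rw [Nat.card_eq_fintype_card, Fintype.card_option]
    have : (0 : ℝ) < Fintype.card α := by positivity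
    push_cast
    rw [div_lt_one (by positivity)]
    linarith
  have hq0 : (0 : ℝ) ≤ 1 / Nat.card (Option α) := by positivity
  obtain ⟨b, hb⟩ := exists_pow_lt_of_lt_one
    (show (0 : ℝ) < β / 2 / (Fintype.card κ₀ + 1) by positivity) hq
  have hb' : Fintype.card κ₀ * (1 / Nat.card (Option α) : ℝ) ^ b ≤ β / 2 := by
    rw [lt_div_iff₀ (by positivity)] at hb
    have := pow_nonneg hq0 b
    nlinarith
  refine ⟨κ₀ × Fin b, inferInstance, fun E hE hd => ?_⟩
  let good : (κ₀ × Fin b → Option α) → Prop := fun x => ∀ r, ∃ s, x (r, s) ≠ none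
  let G : (κ₀ × Fin b → Option α) → ℝ := fun x =>
    av (fun z : κ₀ × Fin b → α => ind ((fun i => (x i).map (fun _ => z i)) ∈ E))
  have hG1 : ∀ x, G x ≤ 1 := fun x => av_le_of_le fun z => ind_le_one _
  have h1 : β / 2 ≤ av (fun x => ind (good x) * G x) := by
    have h2 : av G ≤ av (fun x => ind (good x) * G x +
        ∑ r : κ₀, ind (∀ s, x (r, s) = none)) := by
      apply av_mono
      intro x
      by_cases hx : good x
      · rw [ind_true hx]
        have := Finset.sum_nonneg (s := Finset.univ)
          (fun r _ => ind_nonneg (∀ s, x (r, s) = none))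
        linarith
      · rw [ind_false hx]
        simp only [good] at hx
        push Not at hx
        obtain ⟨r, hr⟩ := hx
        have := Finset.single_le_sum (f := fun r => ind (∀ s, x (r, s) = none))
          (fun r _ => ind_nonneg _) (Finset.mem_univ r)
        simp only [ind_true hr] at this
        linarith [hG1 x]
    rw [av_add, av_sum] at h2
    simp only [av_row] at h2
    rw [Finset.sum_const, Finset.card_univ, nsmul_eq_mul] at h2
    have h3 : av G = av (fun x => ind (x ∈ E)) := av_mask (fun x => ind (x ∈ E))
    linarith
  obtain ⟨x, hx⟩ := exists_of_le_av h1
  have hgood : good x := by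
    by_contra hc
    rw [ind_false hc] at hx
    linarith
  rw [ind_true hgood, one_mul] at hx
  choose s hs using hgood
  obtain ⟨V, hV, hV'⟩ := h₀ (κ₀ × Fin b) (fun r => (r, s r))
    (fun r r' hr => (Prod.ext_iff.1 hr).1)
    {z | (fun i => (x i).map (fun _ => z i)) ∈ E} hx
  refine ⟨⟨fun i => (x i).elim (Sum.inl none) (fun _ => (V.idxFun i).map some id), ?_⟩, ?_⟩
  · intro e
    obtain ⟨i, hi⟩ := V.proper e
    obtain ⟨r, rfl⟩ := hV' i e hi
    obtain ⟨c, hc⟩ := Option.ne_none_iff_exists'.1 (hs r)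
    exact ⟨(r, s r), by simp [hc, hi]⟩
  · intro v
    refine hE _ _ (hV (fun t => (v t).getD a)) ?_
    intro i
    rcases hxi : x i with _ | c
    · left; simp [Subspace.coe_apply, hxi]
    · rcases hVi : V.idxFun i with c' | t
      · left; simp [Subspace.coe_apply, hxi, hVi]
      · right; simp [Subspace.coe_apply, hxi, hVi]

theorem av_range {η κ O : Type} [Finite η] [Finite κ] [Finite O] [Nonempty O]
    (W : Subspace η O κ) (f : (κ → O) → ℝ) :
    av (fun z => f z * ind (∃ v, W v = z)) =
      (Nat.card (η → O) / Nat.card (κ → O) : ℝ) * av (fun v => f (W v)) := by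
  classical
  cases nonempty_fintype η
  cases nonempty_fintype κ
  cases nonempty_fintype O
  have h1 : ∑ z, f z * ind (∃ v, W v = z) = ∑ v, f (W v) := by
    have : ∀ z, f z * ind (∃ v, W v = z) =
        if z ∈ Finset.univ.image (fun v => W v) then f z else 0 := by
      intro z
      simp [ind]
    simp only [this]
    rw [Finset.sum_ite_mem, Finset.univ_inter, Finset.sum_image]
    exact fun x _ y _ hxy => subspace_injective W hxy
  rw [av_eq, av_eq, h1, Nat.card_eq_fintype_card, Nat.card_eq_fintype_card]
  have h2 : (Fintype.card (η → O) : ℝ) ≠ 0 := by positivity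
  have h3 : (Fintype.card (κ → O) : ℝ) ≠ 0 := by positivity
  field_simp

theorem single_aux {α : Type} [Finite α] (a : α) (m : ℕ) (β : ℝ) (hβ : 0 < β)
    (κ : Type) [Finite κ] (hκ : ∀ E : Set (κ → Option α), Ins a Set.univ E →
      β / 2 / 2 ≤ av (fun x => ind (x ∈ E)) → ∃ W : Subspace (Fin m) (Option α) κ, ∀ x, W x ∈ E)
    (c : ℝ) (hc : c = β / 2 / 2 * (Nat.card (Fin m → Option α) / Nat.card (κ → Option α) : ℝ))
    (ι : Type) [Finite ι] (g : (ι → Option α) → ℝ) (hg : ∀ x, g x ≤ 1)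
    (hW : ∀ W : Subspace (Fin m) (Option α) ι, av (fun v => g (W v)) ≤ β / 2) (t : ℕ) :
    ∀ J : Set ι, t * Nat.card κ ≤ J.ncard → ∀ E : Set (ι → Option α), Ins a J E →
      av (fun x => g x * ind (x ∈ E)) ≤ β / 2 * av (fun x => ind (x ∈ E)) +
        max (β / 2) (av (fun x => ind (x ∈ E)) - t * c) := by
  classical
  induction t with
  | zero =>
    intro J _ E _
    have h1 : av (fun x => g x * ind (x ∈ E)) ≤ av (fun x => ind (x ∈ E)) := by
      apply av_mono
      intro x
      nlinarith [hg x, ind_nonneg (x ∈ E)]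
    have h2 : 0 ≤ av (fun x => ind (x ∈ E)) := av_nonneg fun x => ind_nonneg _
    have h3 := le_max_right (β / 2) (av (fun x => ind (x ∈ E)) - (0 : ℕ) * c)
    simp only [Nat.cast_zero, zero_mul, sub_zero] at h3 ⊢
    nlinarith
  | succ t ih =>
    intro J hJ E hE
    by_cases hd : av (fun x => ind (x ∈ E)) < β / 2
    · have h1 : av (fun x => g x * ind (x ∈ E)) ≤ av (fun x => ind (x ∈ E)) := by
        apply av_mono
        intro x
        nlinarith [hg x, ind_nonneg (x ∈ E)]
      have h2 : 0 ≤ av (fun x => ind (x ∈ E)) := av_nonneg fun x => ind_nonneg _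
      have h3 := le_max_left (β / 2) (av (fun x => ind (x ∈ E)) - (t + 1 : ℕ) * c)
      nlinarith
    push Not at hd
    -- choose a block
    obtain ⟨I, hIJ, hI⟩ := Set.exists_subset_card_eq (s := J) (n := Nat.card κ)
      (by nlinarith [Nat.zero_le (t * Nat.card κ)])
    have hcard : Nat.card κ = Nat.card I := by rw [← hI]; rfl
    let e₀ : κ ≃ I := Classical.choice (Finite.card_eq.1 hcard)
    let e : κ → ι := fun j => (e₀ j : ι)
    have he : Function.Injective e := Subtype.val_injective.comp e₀.injective
    have heI : ∀ j, e j ∈ I := fun j => (e₀ j).2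
    have heI' : ∀ i ∈ I, ∃ j, e j = i := fun i hi => ⟨e₀.symm ⟨i, hi⟩, by simp [e]⟩
    let sec : (ι → Option α) → Set (κ → Option α) := fun x => {z | Function.extend e z x ∈ E}
    have hsecIns : ∀ x, Ins a Set.univ (sec x) := by
      intro x z z' hz hzz
      refine hE _ _ hz ?_
      intro i
      by_cases hi : ∃ j, e j = i
      · obtain ⟨j, rfl⟩ := hi
        rw [he.extend_apply, he.extend_apply]
        rcases hzz j with h | h
        · exact Or.inl h
        · exact Or.inr ⟨hIJ (heI j), h.2⟩
      · left
        rw [Function.extend_apply' _ _ _ hi, Function.extend_apply' _ _ _ hi]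
    have hext : ∀ x (z z' : κ → Option α),
        Function.extend e z (Function.extend e z' x) = Function.extend e z x := by
      intro x z z'
      funext i
      by_cases hi : ∃ j, e j = i
      · obtain ⟨j, rfl⟩ := hi
        rw [he.extend_apply, he.extend_apply]
      · simp only [Function.extend_apply' _ _ _ hi]
    have hextc : ∀ x (z : κ → Option α), (Function.extend e z x) ∘ e = z := by
      intro x z
      funext j
      simp [he.extend_apply]
    have hself : ∀ x : ι → Option α, Function.extend e (x ∘ e) x = x := by
      intro x
      funext i
      by_cases hi : ∃ j, e j = i
      · obtain ⟨j, rfl⟩ := hi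
        simp [he.extend_apply]
      · simp only [Function.extend_apply' _ _ _ hi]
    have hsecext : ∀ x z, sec (Function.extend e z x) = sec x := by
      intro x z
      ext w
      simp only [sec, Set.mem_ofPred_eq, hext]
    let good : Set (κ → Option α) → Prop := fun S => Ins a Set.univ S ∧
      β / 2 / 2 ≤ av (fun z => ind (z ∈ S))
    have hΦ : ∀ S : Set (κ → Option α), ∃ U : Set (κ → Option α), good S →
        ∃ W : Subspace (Fin m) (Option α) κ, (∀ x, W x ∈ S) ∧ U = {z | ∃ v, W v = z} := by
      intro S
      by_cases hS : good S
      · obtain ⟨W, hW⟩ := hκ S hS.1 hS.2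
        exact ⟨_, fun _ => ⟨W, hW, rfl⟩⟩
      · exact ⟨∅, fun h => absurd h hS⟩
    choose Φ hΦ using hΦ
    let R : Set (ι → Option α) := {x | good (sec x) ∧ x ∘ e ∈ Φ (sec x)}
    have hRE : R ⊆ E := by
      rintro x ⟨hx1, hx2⟩
      obtain ⟨W, hW1, hW2⟩ := hΦ _ hx1
      rw [hW2] at hx2
      obtain ⟨v, hv⟩ := hx2
      have := hW1 v
      rw [hv] at this
      simpa only [sec, Set.mem_ofPred_eq, hself] using this
    have hins : Ins a (J \ I) (E \ R) := by
      intro x y hx hxy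
      have hxye : x ∘ e = y ∘ e := by
        funext j
        rcases hxy (e j) with h | h
        · exact h
        · exact absurd (heI j) h.1.2
      have hsec : sec x = sec y := by
        ext z
        have key : ∀ x y : ι → Option α, (∀ i, x i = y i ∨
            (i ∈ J \ I ∧ (x i).getD a = (y i).getD a)) → z ∈ sec x → z ∈ sec y := by
          intro x y hxy hz
          refine hE _ _ hz ?_
          intro i
          by_cases hi : ∃ j, e j = i
          · obtain ⟨j, rfl⟩ := hi
            left
            rw [he.extend_apply, he.extend_apply]
          · rw [Function.extend_apply' _ _ _ hi, Function.extend_apply' _ _ _ hi]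
            rcases hxy i with h | h
            · exact Or.inl h
            · exact Or.inr ⟨h.1.1, h.2⟩
        refine ⟨key x y hxy, key y x fun i => ?_⟩
        rcases hxy i with h | h
        · exact Or.inl h.symm
        · exact Or.inr ⟨h.1, h.2.symm⟩
      refine ⟨hE x y hx.1 ?_, ?_⟩
      · intro i
        rcases hxy i with h | h
        · exact Or.inl h
        · exact Or.inr ⟨h.1.1, h.2⟩
      · intro hy
        apply hx.2
        simp only [R, Set.mem_ofPred_eq] at hy ⊢
        rw [hsec, hxye]
        exact hy
    have hcardJ : t * Nat.card κ ≤ (J \ I).ncard := by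
      rw [Set.ncard_sdiff hIJ, hI]
      have : (t + 1) * Nat.card κ = t * Nat.card κ + Nat.card κ := by ring
      omega
    have hIH := ih (J \ I) hcardJ (E \ R) hins
    have hsplit : ∀ x, ind (x ∈ E) = ind (x ∈ E \ R) + ind (x ∈ R) := by
      intro x
      by_cases hxR : x ∈ R
      · rw [ind_true hxR, ind_true (hRE hxR), ind_false (fun h => h.2 hxR)]; ring
      · rw [ind_false hxR, add_zero]
        by_cases hxE : x ∈ E
        · rw [ind_true hxE, ind_true ⟨hxE, hxR⟩]
        · rw [ind_false hxE, ind_false (fun h => hxE h.1)]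
    have hR : ∀ f : (ι → Option α) → ℝ, av (fun x => f x * ind (x ∈ R)) =
        av (fun x => ind (good (sec x)) *
          av (fun z => f (Function.extend e z x) * ind (z ∈ Φ (sec x)))) := by
      intro f
      rw [← av_extend e he]
      apply av_congr
      intro x
      rw [← av_mul_left]
      apply av_congr
      intro z
      have : Function.extend e z x ∈ R ↔ good (sec x) ∧ z ∈ Φ (sec x) := by
        simp only [R, Set.mem_ofPred_eq, hsecext, hextc]
      by_cases hg1 : good (sec x)
      · by_cases hg2 : z ∈ Φ (sec x)
        · rw [ind_true (this.2 ⟨hg1, hg2⟩), ind_true hg1, ind_true hg2]; ring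
        · rw [ind_false (fun h => hg2 (this.1 h).2), ind_false hg2]; ring
      · rw [ind_false (fun h => hg1 (this.1 h).1), ind_false hg1]; ring
    let p : ℝ := (Nat.card (Fin m → Option α) / Nat.card (κ → Option α) : ℝ)
    have hp : 0 ≤ p := by positivity
    have hgR : av (fun x => g x * ind (x ∈ R)) ≤ β / 2 * av (fun x => ind (x ∈ R)) := by
      have h1 : av (fun x => ind (x ∈ R)) = av (fun x => (1 : ℝ) * ind (x ∈ R)) := by simp
      rw [h1, hR g, hR (fun _ => 1), ← av_mul_left]
      apply av_mono
      intro x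
      by_cases hx : good (sec x)
      · rw [ind_true hx]
        obtain ⟨W, hW1, hW2⟩ := hΦ _ hx
        rw [hW2]
        simp only [Set.mem_ofPred_eq]
        rw [av_range W (fun z => g (Function.extend e z x)), av_range W (fun _ => 1), av_const]
        have h3 := hW (semb e he x W)
        simp only [semb_apply] at h3
        have := mul_le_mul_of_nonneg_left h3 hp
        simp only [p] at this
        linarith
      · rw [ind_false hx]; simp
    have hdR : c ≤ av (fun x => ind (x ∈ R)) := by
      have h1 : av (fun x => ind (x ∈ R)) = av (fun x => (1 : ℝ) * ind (x ∈ R)) := by simp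
      rw [h1, hR (fun _ => 1)]
      have h2 : av (fun x => ind (good (sec x)) *
          av (fun z => (1 : ℝ) * ind (z ∈ Φ (sec x)))) = p * av (fun x => ind (good (sec x))) := by
        rw [← av_mul_left]
        apply av_congr
        intro x
        by_cases hx : good (sec x)
        · rw [ind_true hx]
          obtain ⟨W, hW1, hW2⟩ := hΦ _ hx
          rw [hW2]
          simp only [Set.mem_ofPred_eq]
          rw [av_range W (fun _ => 1), av_const]
          simp [p]
        · rw [ind_false hx]; simp
      rw [h2, hc, mul_comm]
      refine mul_le_mul_of_nonneg_left ?_ hp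
      rw [← av_extend e he] at hd
      refine (markov (fun x => av_le_of_le fun z => ind_le_one _) (by positivity) hd).trans ?_
      apply av_mono
      intro x
      apply ind_mono
      intro h
      exact ⟨hsecIns x, h⟩
    have e1 : av (fun x => ind (x ∈ E)) = av (fun x => ind (x ∈ E \ R)) + av (fun x => ind (x ∈ R)) := by
      rw [← av_add]; exact av_congr hsplit
    have e2 : av (fun x => g x * ind (x ∈ E)) =
        av (fun x => g x * ind (x ∈ E \ R)) + av (fun x => g x * ind (x ∈ R)) := by
      rw [← av_add]
      apply av_congr
      intro x
      rw [hsplit x]; ring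
    have e3 : max (β / 2) (av (fun x => ind (x ∈ E \ R)) - t * c) ≤
        max (β / 2) (av (fun x => ind (x ∈ E)) - (t + 1 : ℕ) * c) := by
      apply max_le_max le_rfl
      push_cast
      linarith
    rw [e2]
    have e4 : β / 2 * av (fun x => ind (x ∈ E)) = β / 2 * av (fun x => ind (x ∈ E \ R)) +
      β / 2 * av (fun x => ind (x ∈ R)) := by rw [e1]; ring
    linarith

theorem single {α : Type} [Finite α] [Nonempty α] (h : ∀ δ : ℝ, 0 < δ → DHJat α δ) (a : α)
    (m : ℕ) (β : ℝ) (hβ : 0 < β) : ∃ N : ℕ, ∀ (ι : Type) [Finite ι], N ≤ Nat.card ι →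
      ∀ E : Set (ι → Option α), Ins a Set.univ E → ∀ g : (ι → Option α) → ℝ, (∀ x, g x ≤ 1) →
      β < av (fun x => g x * ind (x ∈ E)) →
      ∃ W : Subspace (Fin m) (Option α) ι, β / 2 < av (fun v => g (W v)) := by
  obtain ⟨κ, _, hκ⟩ := dense_ins h a m (β / 2 / 2) (by positivity)
  set c := β / 2 / 2 * (Nat.card (Fin m → Option α) / Nat.card (κ → Option α) : ℝ) with hc
  have hc0 : 0 < c := by
    have h1 : 0 < Nat.card (Fin m → Option α) := Nat.card_pos
    have h2 : 0 < Nat.card (κ → Option α) := Nat.card_pos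
    positivity
  obtain ⟨t, ht⟩ := exists_nat_ge (1 / c)
  rw [div_le_iff₀ hc0] at ht
  refine ⟨t * Nat.card κ, fun ι _ hι E hE g hg hlt => ?_⟩
  by_contra hcon
  push Not at hcon
  have := single_aux a m β hβ κ hκ c hc ι g hg hcon t Set.univ (by rwa [Set.ncard_univ]) E hE
  have h1 : av (fun x => ind (x ∈ E)) ≤ 1 := av_le_of_le fun x => ind_le_one _
  rw [max_eq_left (by linarith)] at this
  nlinarith

theorem inter {α : Type} [Finite α] [Nonempty α] (h : ∀ δ : ℝ, 0 < δ → DHJat α δ) (m : ℕ)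
    (s : Finset α) : ∀ (β : ℝ), 0 < β → ∃ N : ℕ, ∀ (ι : Type) [Finite ι], N ≤ Nat.card ι →
      ∀ E : α → Set (ι → Option α), (∀ a, Ins a Set.univ (E a)) →
      ∀ g : (ι → Option α) → ℝ, (∀ x, g x ≤ 1) →
      β < av (fun x => g x * ind (∀ a ∈ s, x ∈ E a)) →
      ∃ W : Subspace (Fin m) (Option α) ι, 0 < av (fun v => g (W v)) := by
  classical
  induction s using Finset.induction_on with
  | empty =>
    intro β hβ
    refine ⟨m, fun ι _ hι E _ g hg hlt => ?_⟩
    have h1 : av (fun x => g x * ind (∀ a ∈ (∅ : Finset α), x ∈ E a)) = av g := by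
      apply av_congr
      intro x
      rw [ind_true (by simp)]; ring
    rw [h1] at hlt
    cases nonempty_fintype ι
    obtain ⟨e⟩ : Nonempty (Fin m ↪ ι) := by
      apply Function.Embedding.nonempty_of_card_le
      rwa [Fintype.card_fin, ← Nat.card_eq_fintype_card]
    rw [← av_extend e e.injective] at hlt
    obtain ⟨x, hx⟩ := exists_of_le_av hlt.le
    refine ⟨semb e e.injective x ⟨Sum.inr, fun i => ⟨i, rfl⟩⟩, ?_⟩
    simp only [semb_apply]
    exact lt_of_lt_of_le hβ hx
  | insert a s ha ih =>
    intro β hβ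
    obtain ⟨m₁, hm₁⟩ := ih (β / 2) (by positivity)
    obtain ⟨N, hN⟩ := single h a m₁ β hβ
    refine ⟨N, fun ι _ hι E hE g hg hlt => ?_⟩
    obtain ⟨W, hW⟩ := hN ι hι (E a) (hE a) (fun x => g x * ind (∀ b ∈ s, x ∈ E b))
      (fun x => by
        have h1 := ind_nonneg (∀ b ∈ s, x ∈ E b)
        have h2 := ind_le_one (∀ b ∈ s, x ∈ E b)
        nlinarith [hg x])
      (by
        refine lt_of_lt_of_eq hlt (av_congr fun x => ?_)
        by_cases h1 : x ∈ E a
        · by_cases h2 : ∀ b ∈ s, x ∈ E b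
          · rw [ind_true h1, ind_true h2, ind_true (by simp only [Finset.forall_mem_insert]; exact ⟨h1, h2⟩)]; ring
          · rw [ind_false h2, ind_false (fun h3 => h2 fun b hb => h3 b (Finset.mem_insert_of_mem hb))]
            ring
        · rw [ind_false h1, ind_false (fun h3 => h1 (h3 a (Finset.mem_insert_self a s)))]
          ring)
    obtain ⟨W', hW'⟩ := hm₁ (Fin m₁) (by simp) (fun b => {v | W v ∈ E b}) (by
        intro b x y hx hxy
        refine hE b _ _ hx ?_
        intro i
        simp only [Subspace.coe_apply]
        rcases W.idxFun i with c | t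
        · left; simp
        · simpa using hxy t)
      (fun v => g (W v)) (fun v => hg _) hW
    refine ⟨scomp W W', ?_⟩
    simpa only [scomp_apply] using hW'

end Sz

namespace Sz

open Combinatorics

theorem dhjat_mono {α : Type} [Finite α] {δ δ' : ℝ} (hd : δ ≤ δ') (h : DHJat α δ) :
    DHJat α δ' := by
  obtain ⟨ι, hf, h⟩ := h
  exact ⟨ι, hf, fun A hA => h A (hd.trans hA)⟩

theorem dhjat_fin {α : Type} [Finite α] {δ : ℝ} (h : DHJat α δ) :
    ∃ m : ℕ, ∀ A : Set (Fin m → α), δ ≤ av (fun x => ind (x ∈ A)) →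
      ∃ l : Line α (Fin m), ∀ a, l a ∈ A := by
  obtain ⟨ι, hf, h⟩ := h
  obtain ⟨m, ⟨e⟩⟩ := Finite.exists_equiv_fin ι
  refine ⟨m, fun A hA => ?_⟩
  obtain ⟨l, hl⟩ := h {x | (fun i => x (e.symm i)) ∈ A} (by
    refine hA.trans_eq ?_
    exact (av_equiv (Equiv.arrowCongr e (Equiv.refl α)) (fun x => ind (x ∈ A))).symm)
  refine ⟨⟨fun i => l.idxFun (e.symm i), ?_⟩, fun a => hl a⟩
  obtain ⟨i, hi⟩ := l.proper
  exact ⟨e i, by simpa using hi⟩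

/-- Replace the wildcards of `y` by the letter `i`. -/
def sub {α ι : Type} (y : ι → Option α) (i : α) : ι → Option α := fun j => some ((y j).getD i)

theorem opt_sub {η α ι : Type} (V : Subspace η α ι) (v : η → Option α) (i : α) :
    opt V (sub v i) = sub (opt V v) i := by
  funext j
  simp only [Subspace.coe_apply, opt, sub]
  cases V.idxFun j <;> simp [sub]

theorem ins_sub {α ι : Type} (a : α) (A : Set (ι → Option α)) (T : Prop) :
    Ins a Set.univ {v | sub v a ∈ A ↔ T} := by
  intro x y hx hxy
  have : sub x a = sub y a := by
    funext i
    simp only [sub]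
    rcases hxy i with h | h
    · rw [h]
    · rw [h.2]
  simpa only [Set.mem_ofPred_eq, this] using hx

/-- A wild word gives a line over the bigger alphabet. -/
theorem wild_line {α ι : Type} (A : Set (ι → Option α)) (v : ι → Option α) (hv : ∃ i, v i = none)
    (h1 : v ∈ A) (h2 : ∀ a, sub v a ∈ A) : ∃ l : Line (Option α) ι, ∀ a, l a ∈ A := by
  obtain ⟨i, hi⟩ := hv
  refine ⟨⟨fun j => (v j).map some, i, by simp [hi]⟩, fun a => ?_⟩
  rcases a with _ | a
  · convert h1 using 1
    funext j
    rcases h : v j with _ | b <;> simp [h]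
  · convert h2 a using 1
    funext j
    rcases h : v j with _ | b <;> simp [h, sub]

theorem av_nonwild {α : Type} [Finite α] (d : ℕ) :
    av (fun v : Fin d → Option α => ind (¬ ∃ j, v j = none)) =
      (1 - 1 / Nat.card (Option α) : ℝ) ^ d := by
  have h1 : ∀ v : Fin d → Option α, ind (¬ ∃ j, v j = none) = ∏ j, (1 - ind (v j = none)) := by
    intro v
    have : (¬ ∃ j, v j = none) ↔ ∀ j, v j ≠ none := by push Not; rfl
    rw [this, ind_forall]
    refine Finset.prod_congr rfl fun j _ => ?_
    by_cases hj : v j = none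
    · rw [ind_true hj, ind_false (by simpa using hj)]; ring
    · rw [ind_false hj, ind_true hj]; ring
  rw [av_congr h1, av_indep (fun (_ : Fin d) (o : Option α) => 1 - ind (o = none))]
  simp only [av_sub, av_const, av_ind_eq]
  simp

theorem dhj_step {α : Type} [Finite α] [Nonempty α] (h : ∀ δ : ℝ, 0 < δ → DHJat α δ) :
    ∀ δ : ℝ, 0 < δ → DHJat (Option α) δ := by
  classical
  by_contra hcon
  push Not at hcon
  obtain ⟨δ₀, hδ₀, hno⟩ := hcon
  let S : Set ℝ := {δ | 0 < δ ∧ DHJat (Option α) δ}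
  have hS2 : (2 : ℝ) ∈ S := by
    refine ⟨by norm_num, Unit, inferInstance, fun A hA => ?_⟩
    have : av (fun x => ind (x ∈ A)) ≤ 1 := av_le_of_le fun x => ind_le_one _
    linarith
  have hSlb : ∀ δ ∈ S, δ₀ ≤ δ := by
    intro δ hδ
    by_contra hlt
    exact hno (dhjat_mono (not_le.1 hlt).le hδ.2)
  have hbdd : BddBelow S := ⟨δ₀, hSlb⟩
  obtain ⟨D, hD⟩ : ∃ D, D = sInf S := ⟨_, rfl⟩
  have hD0 : 0 < D := lt_of_lt_of_le hδ₀ (hD ▸ le_csInf ⟨2, hS2⟩ hSlb)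
  have hup : ∀ ε : ℝ, 0 < ε → DHJat (Option α) (D + ε) := by
    intro ε hε
    obtain ⟨δ, hδ, hlt⟩ := exists_lt_of_csInf_lt (s := S) ⟨2, hS2⟩
      (show sInf S < D + ε by rw [← hD]; linarith)
    exact dhjat_mono hlt.le hδ.2
  have hlow : ∀ δ : ℝ, 0 < δ → δ < D → ¬ DHJat (Option α) δ := by
    intro δ hδ hlt hh
    have : sInf S ≤ δ := csInf_le hbdd ⟨hδ, hh⟩
    linarith
  -- parameters
  obtain ⟨κ₀, hκ₀f, hκ₀⟩ := h (D / 2 / 2) (by positivity)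
  have hLne : Nonempty (Line α κ₀) := by
    by_contra hL
    have h1 : D / 2 / 2 ≤ 1 := by
      by_contra h2
      push Not at h2
      have h3 : DHJat (Option α) 1 → 1 ∈ S := fun h => ⟨one_pos, h⟩
      have h4 : DHJat (Option α) 2 := hS2.2
      have h5 := csInf_le hbdd hS2
      linarith
    obtain ⟨l, -⟩ := hκ₀ Set.univ (by
      rw [av_congr (g := fun _ => (1 : ℝ)) (fun x => ind_true (Set.mem_univ x)), av_const]
      exact h1)
    exact hL ⟨l⟩
  have hLc : 0 < (Nat.card (Line α κ₀) : ℝ) := by exact_mod_cast Nat.card_pos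
  obtain ⟨θ, hθ⟩ : ∃ θ : ℝ, θ = D / 2 / 2 / Nat.card (Line α κ₀) := ⟨_, rfl⟩
  have hθ0 : 0 < θ := by rw [hθ]; positivity
  obtain ⟨γ, hγ⟩ : ∃ γ : ℝ, γ = D * θ / 8 := ⟨_, rfl⟩
  have hγ0 : 0 < γ := by rw [hγ]; positivity
  obtain ⟨m, hm⟩ := dhjat_fin (hup γ hγ0)
  let K : ℝ := Nat.card (Set α)
  have hK : 0 < K := by
    have : 0 < Nat.card (Set α) := Nat.card_pos
    simp only [K]
    exact_mod_cast this
  obtain ⟨s, hs⟩ : ∃ s : Finset α, ∀ a, a ∈ s := by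
    cases nonempty_fintype α
    exact ⟨Finset.univ, Finset.mem_univ⟩
  obtain ⟨N, hN⟩ := inter h m s (γ / K / 2) (by positivity)
  have hO : 1 < (Nat.card (Option α) : ℝ) := by
    cases nonempty_fintype α
    rw [Nat.card_eq_fintype_card, Fintype.card_option]
    have : (0 : ℝ) < Fintype.card α := by positivity
    push_cast
    linarith
  have hq0 : (0 : ℝ) ≤ 1 - 1 / Nat.card (Option α) := by
    rw [sub_nonneg, div_le_one (by linarith)]
    exact hO.le
  have hq1 : (1 - 1 / Nat.card (Option α) : ℝ) < 1 := by
    have : (0 : ℝ) < 1 / Nat.card (Option α) := by positivity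
    linarith
  obtain ⟨d₀, hd₀⟩ := exists_pow_lt_of_lt_one (show (0 : ℝ) < min γ (1 / 2) by positivity) hq1
  obtain ⟨d, hd⟩ : ∃ d, d = max d₀ (max N (Nat.card κ₀)) := ⟨_, rfl⟩
  have hdN : N ≤ d := by rw [hd]; exact (le_max_left _ _).trans (le_max_right _ _)
  have hdκ : Nat.card κ₀ ≤ d := by rw [hd]; exact (le_max_right _ _).trans (le_max_right _ _)
  obtain ⟨τ, hτ⟩ : ∃ τ : ℝ, τ = (1 - 1 / Nat.card (Option α) : ℝ) ^ d := ⟨_, rfl⟩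
  have hτ0 : 0 ≤ τ := by rw [hτ]; positivity
  have hτ1 : τ < min γ (1 / 2) := by
    refine lt_of_le_of_lt ?_ hd₀
    rw [hτ]
    exact pow_le_pow_of_le_one hq0 hq1.le (by rw [hd]; exact le_max_left _ _)
  have hτγ : τ < γ := hτ1.trans_le (min_le_left _ _)
  have hτh : τ < 1 / 2 := hτ1.trans_le (min_le_right _ _)
  obtain ⟨ι₁, _, hgr⟩ := gr α Prop d
  have hK₁ : 0 < (Nat.card (ι₁ → Option α) : ℝ) := by exact_mod_cast Nat.card_pos
  obtain ⟨ε, hε⟩ : ∃ ε : ℝ, ε = min γ (D / 2) / (2 * Nat.card (ι₁ → Option α)) := ⟨_, rfl⟩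
  have hmin0 : 0 < min γ (D / 2) := by positivity
  have hε0 : 0 < ε := by rw [hε]; positivity
  have hεη : 2 * ε * Nat.card (ι₁ → Option α) = min γ (D / 2) := by
    rw [hε]; field_simp
  have hεD : ε < D := by
    have h1 : (1 : ℝ) ≤ Nat.card (ι₁ → Option α) := by
      have : 1 ≤ Nat.card (ι₁ → Option α) := Nat.card_pos
      exact_mod_cast this
    have h2 : min γ (D / 2) ≤ D / 2 := min_le_right _ _
    nlinarith
  obtain ⟨ι₂, _, hι₂⟩ := hup ε hε0
  -- a line-free set
  have hex : ∃ A : Set (ι₁ ⊕ ι₂ → Option α), D - ε ≤ av (fun x => ind (x ∈ A)) ∧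
      ¬ ∃ l : Line (Option α) (ι₁ ⊕ ι₂), ∀ a, l a ∈ A := by
    by_contra hc
    push Not at hc
    exact hlow (D - ε) (by linarith) (by linarith) ⟨ι₁ ⊕ ι₂, inferInstance, hc⟩
  obtain ⟨A, hA, hfree⟩ := hex
  rw [av_sumElim] at hA
  -- all sections have density close to `D`
  have hsec : ∀ x : ι₁ → Option α, D - min γ (D / 2) ≤
      av (fun z : ι₂ → Option α => ind (Sum.elim x z ∈ A)) := by
    have hle : ∀ x : ι₁ → Option α,
        av (fun z : ι₂ → Option α => ind (Sum.elim x z ∈ A)) ≤ D + ε := by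
      intro x
      by_contra hc
      push Not at hc
      obtain ⟨l, hl⟩ := hι₂ {z | Sum.elim x z ∈ A} hc.le
      exact hfree ⟨l.vertical x, fun a => by rw [Line.vertical_apply]; exact hl a⟩
    intro x
    have h1 := le_card_mul_av (f := fun x => D + ε -
      av (fun z : ι₂ → Option α => ind (Sum.elim x z ∈ A))) (fun x => by linarith [hle x]) x
    rw [av_sub, av_const] at h1
    have h2 : D + ε - av (fun x => av (fun z : ι₂ → Option α => ind (Sum.elim x z ∈ A)))
        ≤ 2 * ε := by linarith
    have h3 := mul_le_mul_of_nonneg_left h2 hK₁.le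
    linarith
  obtain ⟨V, c0, hV⟩ := hgr (fun y => θ ≤ av (fun z : ι₂ → Option α =>
    ind (∀ i, Sum.elim (sub y i) z ∈ A)))
  -- some wild word is good
  obtain ⟨e⟩ : Nonempty (κ₀ ↪ Fin d) := by
    cases nonempty_fintype κ₀
    apply Function.Embedding.nonempty_of_card_le
    rwa [Fintype.card_fin, ← Nat.card_eq_fintype_card]
  let a0 : α := Classical.arbitrary α
  let P : (κ₀ → α) → (Fin d → Option α) := fun w =>
    Function.extend e (fun j => some (w j)) (fun _ => some a0)
  have hc0 : c0 := by
    obtain ⟨l, hl⟩ := pigeon (L := Line α κ₀) (half_pos hD0)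
      (fun (w : κ₀ → α) (z : ι₂ → Option α) => Sum.elim (opt V (P w)) z ∈ A)
      (fun l z => ∀ a, Sum.elim (opt V (P (l a))) z ∈ A)
      (by
        rw [av_comm]
        apply le_av_of_le
        intro w
        have := hsec (opt V (P w))
        have h2 : min γ (D / 2) ≤ D / 2 := min_le_right _ _
        linarith)
      (fun z hz => hκ₀ {w | Sum.elim (opt V (P w)) z ∈ A} hz)
    rw [← hθ] at hl
    obtain ⟨j, hj⟩ := l.proper
    have h1 := hV (Function.extend e l.idxFun (fun _ => some a0))
      ⟨e j, by rw [e.injective.extend_apply, hj]⟩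
    rw [← h1]
    refine hl.trans_eq (av_congr fun z => ?_)
    congr 1
    apply propext
    refine forall_congr' fun a => ?_
    have : P (l a) = sub (Function.extend e l.idxFun (fun _ => some a0)) a := by
      funext i
      simp only [P, sub]
      by_cases hi : ∃ t, e t = i
      · obtain ⟨t, rfl⟩ := hi
        simp [e.injective.extend_apply]
      · simp [Function.extend_apply' _ _ _ hi]
    rw [← opt_sub, this]
  have hwild : ∀ v : Fin d → Option α, (∃ j, v j = none) →
      θ ≤ av (fun z : ι₂ → Option α => ind (∀ i, Sum.elim (opt V (sub v i)) z ∈ A)) := by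
    intro v hv
    simp only [opt_sub]
    have := hV v hv
    rw [this]
    exact hc0
  -- the sets
  let A' : (ι₂ → Option α) → Set (Fin d → Option α) := fun z => {v | Sum.elim (opt V v) z ∈ A}
  have hfree' : ∀ z, ¬ ∃ l : Line (Option α) (Fin d), ∀ a, l a ∈ A' z := by
    rintro z ⟨l, hl⟩
    refine hfree ⟨(sline (opt V) l).horizontal z, fun a => ?_⟩
    rw [Line.horizontal_apply, sline_apply]
    exact hl a
  let Dz : (ι₂ → Option α) → (Fin d → Option α) → Prop := fun z v => ∀ i, sub v i ∈ A' z
  let g : (ι₂ → Option α) → (Fin d → Option α) → ℝ := fun z v => ind (v ∈ A' z) - (D + γ)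
  have hwildav : av (fun v : Fin d → Option α => ind (∃ j, v j = none)) = 1 - τ := by
    have h1 := av_nonwild (α := α) d
    rw [← hτ] at h1
    rw [← h1, ← av_const (X := Fin d → Option α) 1, ← av_sub]
    apply av_congr
    intro v
    by_cases hv : ∃ j, v j = none
    · rw [ind_true hv, ind_false (by simpa using hv)]; ring
    · rw [ind_false hv, ind_true hv]; ring
  have havD : θ * (1 - τ) ≤ av (fun z => av (fun v => ind (Dz z v))) := by
    rw [av_comm, ← hwildav, ← av_mul_left]
    apply av_mono
    intro v
    by_cases hv : ∃ j, v j = none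
    · rw [ind_true hv, mul_one]; exact hwild v hv
    · rw [ind_false hv, mul_zero]; exact av_nonneg fun z => ind_nonneg _
  have havA : D - γ ≤ av (fun z => av (fun v => ind (v ∈ A' z))) := by
    rw [av_comm]
    apply le_av_of_le
    intro v
    have := hsec (opt V v)
    have h2 : min γ (D / 2) ≤ γ := min_le_left _ _
    refine le_trans ?_ this
    linarith
  have hG : γ ≤ av (fun z => av (fun v => g z v * (1 - ind (Dz z v)))) := by
    have h1 : av (fun z => av (fun v => (ind (v ∈ A' z) - ind (¬ ∃ j, v j = none)) -
        (D + γ) * (1 - ind (Dz z v)))) ≤ av (fun z => av (fun v => g z v * (1 - ind (Dz z v)))) := by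
      apply av_mono
      intro z
      apply av_mono
      intro v
      by_cases hDz : Dz z v
      · rw [ind_true hDz]
        by_cases hv : ∃ j, v j = none
        · have : v ∉ A' z := fun hvA => hfree' z (wild_line (A' z) v hv hvA hDz)
          rw [ind_false this]
          have := ind_nonneg (¬ ∃ j, v j = none)
          linarith
        · rw [ind_true hv]
          have := ind_le_one (v ∈ A' z)
          linarith
      · rw [ind_false hDz]
        simp only [g]
        have := ind_nonneg (¬ ∃ j, v j = none)
        linarith
    refine le_trans ?_ h1
    simp only [av_sub, av_mul_left, av_const]
    rw [av_nonwild, ← hτ]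
    have h2 : (D + γ) * (1 - av (fun z => av (fun v => ind (Dz z v)))) ≤
        (D + γ) * (1 - θ * (1 - τ)) := by
      apply mul_le_mul_of_nonneg_left _ (by positivity)
      linarith
    have h3 : θ * (1 / 2) ≤ θ * (1 - τ) := mul_le_mul_of_nonneg_left (by linarith) hθ0.le
    have h4 : D * (θ * (1 / 2)) ≤ (D + γ) * (θ * (1 - τ)) := by
      apply mul_le_mul _ h3 (by positivity) (by positivity)
      linarith
    nlinarith
  obtain ⟨z, hz⟩ := exists_of_le_av hG
  -- split into patterns
  cases nonempty_fintype α
  have hpat : ∀ v, (1 - ind (Dz z v)) = ∑ T : Set α, ind (T ≠ Set.univ) *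
      ind (∀ a ∈ s, v ∈ {v | sub v a ∈ A' z ↔ a ∈ T}) := by
    intro v
    rw [Finset.sum_eq_single {a | sub v a ∈ A' z}]
    · rw [ind_true (p := ∀ a ∈ s, _) (by intro a _; simp), mul_one]
      by_cases hDz : Dz z v
      · rw [ind_true hDz, ind_false]
        · ring
        · intro hne
          exact hne (Set.eq_univ_of_forall hDz)
      · rw [ind_false hDz, ind_true]
        · ring
        · intro hne
          apply hDz
          intro i
          have : i ∈ {a | sub v a ∈ A' z} := by rw [hne]; trivial
          exact this
    · intro T _ hT
      rw [ind_false (p := ∀ a ∈ s, _), mul_zero]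
      intro hall
      apply hT
      ext a
      exact (hall a (hs a)).symm
    · simp
  simp only [hpat, Finset.mul_sum] at hz
  rw [av_sum] at hz
  have hT : ∃ T : Set α, γ / K / 2 < av (fun v => g z v *
      (ind (T ≠ Set.univ) * ind (∀ a ∈ s, v ∈ {v | sub v a ∈ A' z ↔ a ∈ T}))) := by
    by_contra hc
    push Not at hc
    have h1 := Finset.sum_le_sum (s := Finset.univ) (fun T _ => hc T)
    rw [Finset.sum_const, nsmul_eq_mul, Finset.card_univ, ← Nat.card_eq_fintype_card] at h1
    have h2 : K * (γ / K / 2) = γ / 2 := by field_simp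
    simp only [K] at h2 h1
    linarith
  obtain ⟨T, hT⟩ := hT
  have hTne : T ≠ Set.univ := by
    intro hTu
    rw [ind_false (p := T ≠ Set.univ) (by simpa using hTu)] at hT
    simp only [zero_mul, mul_zero, av_const] at hT
    have : 0 < γ / K / 2 := by positivity
    linarith
  simp only [ind_true hTne, one_mul] at hT
  obtain ⟨W, hW⟩ := hN (Fin d) (by simpa using hdN) (fun a => {v | sub v a ∈ A' z ↔ a ∈ T})
    (fun a => ins_sub a (A' z) (a ∈ T)) (g z)
    (fun v => by
      simp only [g]
      have := ind_le_one (v ∈ A' z)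
      linarith) hT
  simp only [g, av_sub, av_const] at hW
  obtain ⟨l, hl⟩ := hm {v | W v ∈ A' z} (by
    have h5 : 0 < av (fun v => ind (W v ∈ A' z)) - (D + γ) := hW
    have : av (fun x => ind (x ∈ {v | W v ∈ A' z})) = av (fun v => ind (W v ∈ A' z)) := rfl
    linarith)
  exact hfree' z ⟨sline W l, fun a => by rw [sline_apply]; exact hl a⟩

theorem dhjat_equiv {α β : Type} [Finite α] [Finite β] (e : α ≃ β) {δ : ℝ} (h : DHJat α δ) :
    DHJat β δ := by
  obtain ⟨ι, hf, h⟩ := h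
  refine ⟨ι, hf, fun A hA => ?_⟩
  obtain ⟨l, hl⟩ := h {x | (fun i => e (x i)) ∈ A} (by
    refine hA.trans_eq ?_
    exact (av_equiv (Equiv.arrowCongr (Equiv.refl ι) e) (fun x => ind (x ∈ A))).symm)
  refine ⟨l.map e, fun a => ?_⟩
  have := hl (e.symm a)
  have h2 := Line.map_apply e l (e.symm a)
  rw [Equiv.apply_symm_apply] at h2
  rw [h2]
  exact this

/-- **Density Hales-Jewett.** -/
theorem dhj (k : ℕ) : ∀ δ : ℝ, 0 < δ → DHJat (Fin (k + 1)) δ := by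
  induction k with
  | zero =>
    intro δ hδ
    refine ⟨Unit, inferInstance, fun A hA => ?_⟩
    obtain ⟨x, hx⟩ := exists_of_le_av hA
    have hxA : x ∈ A := by
      by_contra hxA
      rw [ind_false hxA] at hx
      linarith
    refine ⟨Line.diagonal _ _, fun a => ?_⟩
    convert hxA using 1
    funext i
    exact Subsingleton.elim (α := Fin 1) _ _
  | succ k ih =>
    intro δ hδ
    exact dhjat_equiv (finSuccEquiv (k + 1)).symm (dhj_step ih δ hδ)

/-- Pulling back a function on `G × G` along a line. -/
theorem av_line {G ι : Type} [AddCommGroup G] [Finite G] [Finite ι] (i0 : ι)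
    (φ ψ : (ι → G) → G) (hφ : ∀ r t, φ (Function.extend (fun _ : Unit => i0) t r) = φ r)
    (hψ : ∀ r t, ψ (Function.extend (fun _ : Unit => i0) t r) = t () +
      ψ (Function.extend (fun _ : Unit => i0) (fun _ => 0) r))
    (F : G → G → ℝ) :
    av (fun r : ι → G => av (fun a => F (a + φ r) (ψ r))) = av (fun x => av (fun r => F x r)) := by
  have h1 : ∀ r : ι → G, av (fun a => F (a + φ r) (ψ r)) = av (fun a => F a (ψ r)) := by
    intro r
    exact av_equiv (Equiv.addRight (φ r)) (fun a => F a (ψ r))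
  rw [av_congr h1, ← av_extend (fun _ : Unit => i0) (fun _ _ _ => rfl)]
  have h2 : ∀ r : ι → G, av (fun t : Unit → G =>
      av (fun a => F a (ψ (Function.extend (fun _ : Unit => i0) t r)))) =
      av (fun x => av (fun r => F x r)) := by
    intro r
    rw [av_comm]
    apply av_congr
    intro x
    rw [av_congr (fun t => by rw [hψ r t])]
    rw [← av_equiv (Equiv.funUnique Unit G).symm]
    exact av_equiv (Equiv.addRight
      (ψ (Function.extend (fun _ : Unit => i0) (fun _ => 0) r))) (fun t => F x t)
  rw [av_congr h2, av_const]

theorem szem (k : ℕ) (δ : ℝ) (hδ : 0 < δ) : ∃ c : ℝ, 0 < c ∧ ∀ (N : ℕ) [NeZero N]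
    (A : Set (ZMod N)), δ ≤ av (fun x => ind (x ∈ A)) →
    c ≤ av (fun x : ZMod N => av (fun r : ZMod N =>
      ind (∀ j ∈ Finset.range (k + 1), x + (j : ZMod N) * r ∈ A))) := by
  classical
  obtain ⟨ι, _, h⟩ := dhj k (δ / 2) (half_pos hδ)
  refine ⟨δ / 2 / (Nat.card (Line (Fin (k + 1)) ι) + 1), by positivity, fun N _ A hA => ?_⟩
  cases nonempty_fintype ι
  obtain ⟨l, hl⟩ := pigeon (L := Line (Fin (k + 1)) ι) hδ
    (fun (x : ι → Fin (k + 1)) (p : (ι → ZMod N) × ZMod N) =>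
      p.2 + ∑ i, ((x i : ℕ) : ZMod N) * p.1 i ∈ A)
    (fun l p => ∀ a, p.2 + ∑ i, ((l a i : ℕ) : ZMod N) * p.1 i ∈ A)
    (by
      rw [av_comm]
      apply le_av_of_le
      intro x
      rw [av_prod]
      apply le_av_of_le
      intro r
      refine hA.trans_eq ?_
      exact (av_equiv (Equiv.addRight (∑ i, ((x i : ℕ) : ZMod N) * r i))
        (fun a => ind (a ∈ A))).symm)
    (fun p hp => h {x | p.2 + ∑ i, ((x i : ℕ) : ZMod N) * p.1 i ∈ A} hp)
  have hLc : 0 < (Nat.card (Line (Fin (k + 1)) ι) : ℝ) := by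
    have : Nonempty (Line (Fin (k + 1)) ι) := ⟨l⟩
    exact_mod_cast Nat.card_pos
  have h1 : δ / 2 / (Nat.card (Line (Fin (k + 1)) ι) + 1) ≤
      δ / 2 / Nat.card (Line (Fin (k + 1)) ι) := by
    gcongr
    linarith
  refine (h1.trans hl).trans_eq ?_
  rw [av_prod]
  obtain ⟨i0, hi0⟩ := l.proper
  let φ : (ι → ZMod N) → ZMod N := fun r =>
    ∑ i, (l.idxFun i).elim 0 (fun b => ((b : ℕ) : ZMod N) * r i)
  let ψ : (ι → ZMod N) → ZMod N := fun r => ∑ i, (l.idxFun i).elim (r i) (fun _ => 0)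
  have hinj : Function.Injective (fun _ : Unit => i0) := fun _ _ _ => rfl
  have hne : ∀ i, i ≠ i0 → ¬ ∃ u : Unit, (fun _ : Unit => i0) u = i := by
    rintro i hi ⟨_, h⟩
    exact hi h.symm
  rw [← av_line i0 φ ψ ?_ ?_
    (fun x r => ind (∀ j ∈ Finset.range (k + 1), x + (j : ZMod N) * r ∈ A))]
  · apply av_congr
    intro r
    apply av_congr
    intro x
    have key : ∀ a : Fin (k + 1), x + ∑ i, ((l a i : ℕ) : ZMod N) * r i =
        x + φ r + ((a : ℕ) : ZMod N) * ψ r := by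
      intro a
      simp only [φ, ψ, Finset.mul_sum]
      rw [add_assoc, ← Finset.sum_add_distrib]
      congr 1
      refine Finset.sum_congr rfl fun i _ => ?_
      rcases hli : l.idxFun i with _ | b <;> simp [hli]
    congr 1
    apply propext
    constructor
    · intro hh j hj
      have := hh ⟨j, Finset.mem_range.1 hj⟩
      rwa [key] at this
    · intro hh a
      rw [key]
      exact hh a (Finset.mem_range.2 a.2)
  · intro r t
    refine Finset.sum_congr rfl fun i _ => ?_
    by_cases hi : i = i0
    · subst hi; simp [hi0]
    · rw [Function.extend_apply' _ _ _ (hne i hi)]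
  · intro r t
    simp only [ψ]
    rw [← Finset.add_sum_erase _ _ (Finset.mem_univ i0),
      ← Finset.add_sum_erase Finset.univ (fun i => (l.idxFun i).elim
        (Function.extend (fun _ : Unit => i0) (fun _ => (0 : ZMod N)) r i) (fun _ => 0))
        (Finset.mem_univ i0)]
    have e1 : Function.extend (fun _ : Unit => i0) t r i0 = t () := hinj.extend_apply t r ()
    have e2 : Function.extend (fun _ : Unit => i0) (fun _ => (0 : ZMod N)) r i0 = 0 :=
      hinj.extend_apply _ r ()
    simp only [hi0, Option.elim_none, e1, e2, zero_add]
    congr 1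
    refine Finset.sum_congr rfl fun i hi => ?_
    have hi' := Finset.ne_of_mem_erase hi
    rw [Function.extend_apply' _ _ _ (hne i hi'), Function.extend_apply' _ _ _ (hne i hi')]

end Sz

/-- **Quantitative recurrence form of Szemerédi's theorem.**  For every `k ≥ 1` and
`0 < δ ≤ 1` there are `c(k,δ) > 0` and `N₀(k,δ)` such that for every prime `N ≥ N₀` and every
`f : Z_N → [0,1]` with `E(f | Z_N) ≥ δ` one has
`E( ∏_{j=0}^{k-1} f(x + jr) | x, r ∈ Z_N ) ≥ c(k,δ)`. -/
theorem szemeredi_quantitative_recurrence (k : ℕ) (hk : 1 ≤ k)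
    (δ : ℝ) (hδ0 : 0 < δ) (hδ1 : δ ≤ 1) :
    ∃ c : ℝ, 0 < c ∧ ∃ N₀ : ℕ, 1 ≤ N₀ ∧
      ∀ (N : ℕ) [NeZero N], N.Prime → N₀ ≤ N →
        ∀ f : ZMod N → ℝ, (∀ x, 0 ≤ f x ∧ f x ≤ 1) →
          δ ≤ (∑ x : ZMod N, f x) / (N : ℝ) →
          c ≤ (∑ x : ZMod N, ∑ r : ZMod N,
                ∏ j ∈ Finset.range k, f (x + (j : ZMod N) * r)) / (N : ℝ) ^ 2 := by
  obtain ⟨k, rfl⟩ : ∃ k', k = k' + 1 := ⟨k - 1, by omega⟩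
  obtain ⟨c, hc, h⟩ := Sz.szem k (δ / 2) (half_pos hδ0)
  refine ⟨c * (δ / 2) ^ (k + 1), by positivity, 1, le_rfl, ?_⟩
  intro N _ _ _ f hf hd
  have hd' : δ ≤ Sz.av f := by rwa [Sz.av_eq, ZMod.card]
  have h1 := h N {x | δ / 2 ≤ f x} (Sz.markov (fun x => (hf x).2) hδ0.le hd')
  have h2 : (∑ x : ZMod N, ∑ r : ZMod N,
      ∏ j ∈ Finset.range (k + 1), f (x + (j : ZMod N) * r)) / (N : ℝ) ^ 2 =
      Sz.av (fun x : ZMod N => Sz.av (fun r : ZMod N =>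
        ∏ j ∈ Finset.range (k + 1), f (x + (j : ZMod N) * r))) := by
    simp only [Sz.av_eq, ZMod.card, ← Finset.sum_div]
    rw [div_div, sq]
  rw [h2, mul_comm]
  refine (mul_le_mul_of_nonneg_left h1 (by positivity)).trans ?_
  rw [← Sz.av_mul_left]
  apply Sz.av_mono
  intro x
  rw [← Sz.av_mul_left]
  apply Sz.av_mono
  intro r
  by_cases hp : ∀ j ∈ Finset.range (k + 1), x + (j : ZMod N) * r ∈ {x | δ / 2 ≤ f x}
  · rw [Sz.ind_true hp, mul_one]
    have := Finset.prod_le_prod (s := Finset.range (k + 1)) (f := fun _ : ℕ => δ / 2)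
      (g := fun j : ℕ => f (x + (j : ZMod N) * r)) (fun _ _ => by positivity) (fun j hj => hp j hj)
    rw [Finset.prod_const, Finset.card_range] at this
    exact this
  · rw [Sz.ind_false hp, mul_zero]
    exact Finset.prod_nonneg fun j _ => (hf _).1
end

section
/- Suppose that for every integer k ≥ 1 and real 0 < δ ≤ 1 there exist a constant c(k,δ) > 0 and an integer N₀(k,δ) such that for every prime N ≥ N₀(k,δ) and every f: Z_N → [0,1] with E(f | Z_N) ≥ δ one has E( ∏_{j=0}^{k-1} f(x + jr) | x, r ∈ Z_N ) ≥ c(k,δ). Then for every integer k ≥ 1 and real 0 < δ ≤ 1 there exists an integer N_SZ(k,δ) such that for every N ≥ N_SZ(k,δ), every set A ⊆ {1,...,N} with |A| ≥ δN contains a proper arithmetic progression of length k (i.e. a, a+r, ..., a+(k-1)r ∈ A for some r ≥ 1). -/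
/-- The quantitative recurrence form of Szemerédi's theorem on `Z_N` (for primes `N`) implies
the standard form of Szemerédi's theorem: every `A ⊆ {1,…,N}` with `|A| ≥ δN` (for `N` large
enough depending on `k` and `δ`) contains a proper arithmetic progression of length `k`. -/
theorem szemeredi_of_quantitative_recurrence
    (H : ∀ (k : ℕ), 1 ≤ k → ∀ (δ : ℝ), 0 < δ → δ ≤ 1 →
      ∃ c : ℝ, 0 < c ∧ ∃ N₀ : ℕ,
        ∀ (N : ℕ) [NeZero N], N.Prime → N₀ ≤ N →
          ∀ f : ZMod N → ℝ, (∀ x, 0 ≤ f x ∧ f x ≤ 1) →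
            δ ≤ (∑ x : ZMod N, f x) / (N : ℝ) →
            c ≤ (∑ x : ZMod N, ∑ r : ZMod N,
                  ∏ j ∈ Finset.range k, f (x + (j : ZMod N) * r)) / (N : ℝ) ^ 2) :
    ∀ (k : ℕ), 1 ≤ k → ∀ (δ : ℝ), 0 < δ → δ ≤ 1 →
      ∃ N₀ : ℕ, ∀ N : ℕ, N₀ ≤ N →
        ∀ A : Finset ℕ, A ⊆ Finset.Icc 1 N → δ * (N : ℝ) ≤ (A.card : ℝ) →
          ∃ a r : ℕ, 1 ≤ r ∧ ∀ j < k, a + j * r ∈ A := by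
  classical
  intro k hk δ hδ hδ1
  obtain ⟨c, hc, M₀, h⟩ := H (k + 1) (by omega) (δ / 4) (by linarith) (by linarith)
  refine ⟨max M₀ (⌈1 / c⌉₊) + 1, ?_⟩
  intro N hN A hA hcard
  have hN1 : M₀ ≤ N := by have := le_max_left M₀ (⌈1 / c⌉₊); omega
  have hN2 : ⌈1 / c⌉₊ ≤ N := by have := le_max_right M₀ (⌈1 / c⌉₊); omega
  have hN0 : 1 ≤ N := by omega
  obtain ⟨M, hMp, hM1, hM2⟩ := Nat.exists_prime_lt_and_le_two_mul (2 * N) (by omega)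
  have : NeZero M := ⟨hMp.ne_zero⟩
  have hMpos : (0 : ℝ) < M := by exact_mod_cast hMp.pos
  have hbd : ∀ a ∈ A, 1 ≤ a ∧ a ≤ N := fun a ha => Finset.mem_Icc.1 (hA ha)
  set B : Finset (ZMod M) := A.image (fun a : ℕ => (a : ZMod M)) with hB
  have hBcard : B.card = A.card := by
    apply Finset.card_image_of_injOn
    intro a ha b hb hab
    have ha' := hbd a ha
    have hb' := hbd b hb
    have hab' : a ≡ b [MOD M] := (ZMod.natCast_eq_natCast_iff _ _ _).1 hab
    exact Nat.ModEq.eq_of_lt_of_lt hab' (by omega) (by omega)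
  have hsum := h M hMp (by omega) (fun y => if y ∈ B then 1 else 0)
    (fun y => by split_ifs <;> norm_num) (by
      rw [Finset.sum_boole, le_div_iff₀ hMpos]
      have h1 : (Finset.univ.filter (fun y => y ∈ B)) = B := by ext; simp
      rw [h1, hBcard]
      have h2 : (M : ℝ) ≤ 4 * N := by exact_mod_cast (by omega : M ≤ 4 * N)
      nlinarith)
  rw [le_div_iff₀ (by positivity)] at hsum
  have hcM : 1 < c * M := by
    have h1 : 1 / c ≤ N := (Nat.le_ceil _).trans (by exact_mod_cast hN2)
    have h2 : (N : ℝ) < M := by exact_mod_cast (by omega : N < M)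
    have h3 : 1 / c < M := lt_of_le_of_lt h1 h2
    rw [div_lt_iff₀ hc] at h3
    linarith
  have key : ∃ x r : ZMod M, r ≠ 0 ∧ ∀ j < k + 1, x + (j : ZMod M) * r ∈ B := by
    by_contra! hno
    have hle : ∀ x r : ZMod M, (∏ j ∈ Finset.range (k + 1),
        (if x + (j : ZMod M) * r ∈ B then (1 : ℝ) else 0)) ≤ if r = 0 then 1 else 0 := by
      intro x r
      split_ifs with hr
      · apply Finset.prod_le_one
        · intro i _; split_ifs <;> norm_num
        · intro i _; split_ifs <;> norm_num
      · obtain ⟨j, hj, hjB⟩ := hno x r hr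
        rw [Finset.prod_eq_zero (Finset.mem_range.2 hj) (by rw [if_neg hjB])]
    have h5 : c * (M : ℝ) ^ 2 ≤ M := by
      refine hsum.trans ((Finset.sum_le_sum fun x _ => Finset.sum_le_sum fun r _ => hle x r).trans ?_)
      simp [ZMod.card]
    nlinarith
  obtain ⟨x, r, hr, hx⟩ := key
  have hex : ∀ j : ℕ, ∃ a : ℕ, j < k + 1 → a ∈ A ∧ (a : ZMod M) = x + (j : ZMod M) * r := by
    intro j
    by_cases hj : j < k + 1
    · obtain ⟨a, ha, hax⟩ := Finset.mem_image.1 (hx j hj)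
      exact ⟨a, fun _ => ⟨ha, hax⟩⟩
    · exact ⟨0, fun hh => absurd hh hj⟩
  choose u hu using hex
  have hu0 := hu 0 (by omega)
  have hu1 := hu 1 (by omega)
  obtain ⟨d, hd⟩ : ∃ d : ℤ, d = (u 1 : ℤ) - u 0 := ⟨_, rfl⟩
  have hdr : (d : ZMod M) = r := by
    rw [hd]; push_cast; rw [hu0.2, hu1.2]; push_cast; ring
  have hd0 : d ≠ 0 := by
    rintro rfl
    exact hr (by rw [← hdr]; simp)
  have b0 := hbd _ hu0.1
  have b1 := hbd _ hu1.1
  have hform : ∀ j : ℕ, j < k + 1 → (u j : ℤ) = u 0 + j * d := by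
    intro j
    induction j with
    | zero => intro _; simp
    | succ j ih =>
      intro hj
      have ih' := ih (by omega)
      have p := hu j (by omega)
      have q := hu (j + 1) hj
      have bp := hbd _ p.1
      have bq := hbd _ q.1
      have hz : (((u (j + 1) : ℤ) - u j - d : ℤ) : ZMod M) = 0 := by
        push_cast; rw [p.2, q.2, hdr]; push_cast; ring
      have hdvd := (ZMod.intCast_zmod_eq_zero_iff_dvd _ M).1 hz
      have hzero := Int.eq_zero_of_abs_lt_dvd hdvd (by rw [abs_lt]; constructor <;> omega)
      push_cast
      linarith
  rcases lt_or_gt_of_ne hd0 with hneg | hpos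
  · refine ⟨u k, d.natAbs, by omega, fun j hj => ?_⟩
    have e : u k + j * d.natAbs = u (k - j) := by
      have e1 := hform k (by omega)
      have e2 := hform (k - j) (by omega)
      zify
      rw [abs_of_neg hneg, e1, e2, Nat.cast_sub hj.le]
      ring
    rw [e]
    exact (hu (k - j) (by omega)).1
  · refine ⟨u 0, d.natAbs, by omega, fun j hj => ?_⟩
    have e : u 0 + j * d.natAbs = u j := by
      have e1 := hform j (by omega)
      zify
      rw [abs_of_pos hpos, e1]
    rw [e]
    exact (hu j (by omega)).1
end
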